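/- arXiv:0708.2754 — 2 statements merged into one kernel-verified Lean document; each statement's English description precedes it below -/
import Mathlib

section
/- (Expected equidistribution on the unit circle for the Kac-type ensemble orthonormalized on the circle.) For N ≥ 1 and c = (c_0, …, c_N) ∈ ℂ^{N+1} let f_{N,c}(z) = ∑_{j=0}^N c_j z^j. Then for every continuous compactly supported function φ : ℂ → ℝ, (1/N) ∫_{ℂ^{N+1}} ( ∑_{a ∈ Z(f_{N,c})} φ(a) ) dγ_{N+1}(c) → (1/2π) ∫_0^{2π} φ(e^{iθ}) dθ as N → ∞. -/
open MeasureTheory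

noncomputable instance (n : ℕ) : MeasurableSpace (EuclideanSpace ℂ (Fin n)) := borel _
instance (n : ℕ) : BorelSpace (EuclideanSpace ℂ (Fin n)) := ⟨rfl⟩

/-- The standard complex Gaussian measure `γₙ` on `ℂⁿ`, with density
`c ↦ π⁻ⁿ exp(-‖c‖²)` with respect to Lebesgue measure on `ℂⁿ ≅ ℝ²ⁿ`. -/
noncomputable def gammaC (n : ℕ) : Measure (EuclideanSpace ℂ (Fin n)) :=
  volume.withDensity fun c => ENNReal.ofReal ((Real.pi ^ n)⁻¹ * Real.exp (-‖c‖ ^ 2))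

theorem integral_exp_neg_sq_norm_complex :
    ∫ z : ℂ, Real.exp (-‖z‖ ^ 2) = Real.pi := by
  have h := GaussianFourier.integral_rexp_neg_mul_sq_norm (V := ℂ) (b := 1) one_pos
  simpa [Complex.finrank_real_complex] using h

theorem integrable_exp_neg_sq_norm_complex :
    Integrable fun z : ℂ => Real.exp (-‖z‖ ^ 2) :=
  .of_integral_ne_zero (by rw [integral_exp_neg_sq_norm_complex]; exact Real.pi_ne_zero)

theorem exp_neg_sq_norm_eq_prod {n : ℕ} (c : Fin n → ℂ) :
    Real.exp (-‖WithLp.toLp 2 c‖ ^ 2) = ∏ i, Real.exp (-‖c i‖ ^ 2) := by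
  rw [← Real.exp_sum, EuclideanSpace.norm_sq_eq, Finset.sum_neg_distrib]

theorem volume_preserving_toLp_complex (n : ℕ) :
    MeasurePreserving (WithLp.toLp 2 : (Fin n → ℂ) → EuclideanSpace ℂ (Fin n)) := by
  have hm : Measurable (WithLp.toLp 2 : (Fin n → ℂ) → EuclideanSpace ℂ (Fin n)) :=
    (PiLp.continuous_toLp 2 _).measurable
  refine ⟨hm, ?_⟩
  let e : (Fin n → ℂ) ≃L[ℝ] EuclideanSpace ℂ (Fin n) :=
    (PiLp.continuousLinearEquiv 2 ℝ fun _ : Fin n => ℂ).symm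
  have : (Measure.map (WithLp.toLp 2 : (Fin n → ℂ) → EuclideanSpace ℂ (Fin n))
      volume).IsAddHaarMeasure :=
    e.isAddHaarMeasure_map volume
  set ν := Measure.map (WithLp.toLp 2 : (Fin n → ℂ) → EuclideanSpace ℂ (Fin n)) volume
  have hν : ν = Measure.addHaarScalarFactor ν volume • volume :=
    Measure.isAddLeftInvariant_eq_smul ν volume
  have h1 : ∫ v, Real.exp (-‖v‖ ^ 2) ∂ν = Real.pi ^ n := by
    rw [integral_map hm.aemeasurable (by fun_prop)]
    simp_rw [exp_neg_sq_norm_eq_prod]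
    rw [integral_fintype_prod_volume_eq_prod (fun (_ : Fin n) z => Real.exp (-‖z‖ ^ 2))]
    simp [integral_exp_neg_sq_norm_complex]
  have h2 : ∫ v : EuclideanSpace ℂ (Fin n), Real.exp (-‖v‖ ^ 2) = Real.pi ^ n := by
    have h := GaussianFourier.integral_rexp_neg_mul_sq_norm
      (V := EuclideanSpace ℂ (Fin n)) (b := 1) one_pos
    have hf : Module.finrank ℝ (EuclideanSpace ℂ (Fin n)) = n * 2 := by
      rw [← e.toLinearEquiv.finrank_eq, Module.finrank_pi_fintype]
      simp [Complex.finrank_real_complex]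
    rw [hf] at h
    simpa using h
  have h3 : (Measure.addHaarScalarFactor ν volume : ℝ) = 1 := by
    rw [hν, integral_smul_nnreal_measure, h2, NNReal.smul_def, smul_eq_mul] at h1
    exact mul_right_cancel₀ (pow_ne_zero n Real.pi_ne_zero) (by rw [h1, one_mul])
  rw [hν, show Measure.addHaarScalarFactor ν volume = 1 from mod_cast h3, one_smul]

theorem ae_gammaC_apply_ne_zero {n : ℕ} (j : Fin n) : ∀ᵐ c ∂gammaC n, c j ≠ 0 := by
  refine (withDensity_absolutelyContinuous _ _).ae_le ?_
  change ∀ᵐ c : EuclideanSpace ℂ (Fin n), c j ≠ 0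
  rw [← (volume_preserving_toLp_complex n).map_eq]
  have hs : MeasurableSet {c : EuclideanSpace ℂ (Fin n) | c j ≠ 0} :=
    (isOpen_ne_fun (by fun_prop) continuous_const).measurableSet
  rw [ae_map_iff (volume_preserving_toLp_complex n).measurable.aemeasurable hs]
  exact (Measure.quasiMeasurePreserving_eval (fun _ : Fin n => (volume : Measure ℂ)) j).ae
    (Measure.ae_ne volume 0)

theorem gammaC_density_toLp {n : ℕ} (c : Fin n → ℂ) :
    (Real.pi ^ n)⁻¹ * Real.exp (-‖WithLp.toLp 2 c‖ ^ 2) =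
      ∏ i, Real.pi⁻¹ * Real.exp (-‖c i‖ ^ 2) := by
  rw [exp_neg_sq_norm_eq_prod, Finset.prod_mul_distrib]
  simp

theorem integral_gammaC {n : ℕ} (F : EuclideanSpace ℂ (Fin n) → ℝ) :
    ∫ c, F c ∂gammaC n = ∫ c : Fin n → ℂ,
      (∏ i, Real.pi⁻¹ * Real.exp (-‖c i‖ ^ 2)) * F (WithLp.toLp 2 c) := by
  rw [gammaC, integral_withDensity_eq_integral_toReal_smul (by fun_prop) (by simp),
    ← (volume_preserving_toLp_complex n).integral_comp
      (MeasurableEquiv.measurableEmbedding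
        (PiLp.homeomorph 2 fun _ : Fin n => ℂ).symm.toMeasurableEquiv)]
  refine integral_congr_ae (.of_forall fun c => ?_)
  simp only [smul_eq_mul]
  rw [ENNReal.toReal_ofReal (by positivity), gammaC_density_toLp]

theorem integrable_gammaC_iff {n : ℕ} {F : EuclideanSpace ℂ (Fin n) → ℝ} :
    Integrable F (gammaC n) ↔ Integrable fun c : Fin n → ℂ =>
      (∏ i, Real.pi⁻¹ * Real.exp (-‖c i‖ ^ 2)) * F (WithLp.toLp 2 c) := by
  rw [gammaC, integrable_withDensity_iff_integrable_smul' (by fun_prop) (by simp),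
    ← (volume_preserving_toLp_complex n).integrable_comp_emb
      (MeasurableEquiv.measurableEmbedding
        (PiLp.homeomorph 2 fun _ : Fin n => ℂ).symm.toMeasurableEquiv)]
  refine integrable_congr (.of_forall fun c => ?_)
  simp only [smul_eq_mul, Function.comp_apply]
  rw [ENNReal.toReal_ofReal (by positivity), gammaC_density_toLp]

theorem prod_mul_apply_eq {n : ℕ} (j : Fin n) (h g : ℂ → ℝ) (c : Fin n → ℂ) :
    (∏ i, h (c i)) * g (c j) =
      ∏ i, (fun z => h z * if i = j then g z else 1) (c i) := by
  rw [Finset.prod_mul_distrib]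
  simp

theorem integrable_comp_apply_gammaC {n : ℕ} (j : Fin n) {g : ℂ → ℝ}
    (hg : Integrable fun z => Real.exp (-‖z‖ ^ 2) * g z) :
    Integrable (fun c => g (c j)) (gammaC n) := by
  rw [integrable_gammaC_iff]
  simp_rw [prod_mul_apply_eq j (fun z => Real.pi⁻¹ * Real.exp (-‖z‖ ^ 2)) g]
  refine Integrable.fintype_prod (f := fun i z =>
    Real.pi⁻¹ * Real.exp (-‖z‖ ^ 2) * if i = j then g z else 1) fun i => ?_
  split_ifs
  · simpa only [mul_assoc] using hg.const_mul Real.pi⁻¹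
  · simpa using integrable_exp_neg_sq_norm_complex.const_mul Real.pi⁻¹

theorem integral_comp_apply_gammaC {n : ℕ} (j : Fin n) (g : ℂ → ℝ) :
    ∫ c, g (c j) ∂gammaC n = Real.pi⁻¹ * ∫ z, Real.exp (-‖z‖ ^ 2) * g z := by
  rw [integral_gammaC]
  simp_rw [prod_mul_apply_eq j (fun z => Real.pi⁻¹ * Real.exp (-‖z‖ ^ 2)) g]
  rw [integral_fintype_prod_volume_eq_prod (fun i z =>
    Real.pi⁻¹ * Real.exp (-‖z‖ ^ 2) * if i = j then g z else 1),
    Finset.prod_eq_single_of_mem j (Finset.mem_univ j)]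
  · simp_rw [if_true, mul_assoc, integral_const_mul]
  · intro i _ hij
    simp [hij, integral_const_mul, integral_exp_neg_sq_norm_complex, Real.pi_ne_zero]

instance isProbabilityMeasure_gammaC (n : ℕ) : IsProbabilityMeasure (gammaC n) := by
  have h : ∫ _, (1 : ℝ) ∂gammaC n = 1 := by
    rw [integral_gammaC]
    simp_rw [mul_one]
    rw [integral_fintype_prod_volume_eq_prod (fun (_ : Fin n) z =>
      Real.pi⁻¹ * Real.exp (-‖z‖ ^ 2))]
    simp [integral_const_mul, integral_exp_neg_sq_norm_complex, Real.pi_ne_zero]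
  rw [integral_const, smul_eq_mul, mul_one] at h
  exact ⟨by rwa [measureReal_def, ENNReal.toReal_eq_one_iff] at h⟩

theorem integrable_exp_neg_sq_norm_mul_norm_rpow {q : ℝ} (hq : -2 < q) :
    Integrable fun z : ℂ => Real.exp (-‖z‖ ^ 2) * ‖z‖ ^ q := by
  refine .of_integral_ne_zero ?_
  have h := Complex.integral_rpow_mul_exp_neg_rpow one_le_two hq
  simp_rw [Real.rpow_two, mul_comm (‖_‖ ^ q)] at h
  rw [h]
  have := Real.Gamma_pos_of_pos (show 0 < (q + 2) / 2 by linarith)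
  positivity

theorem measurePreserving_gammaC {n : ℕ}
    (e : EuclideanSpace ℂ (Fin n) ≃ₗᵢ[ℝ] EuclideanSpace ℂ (Fin n)) :
    MeasurePreserving e (gammaC n) (gammaC n) := by
  refine ⟨e.continuous.measurable, ?_⟩
  ext s hs
  have hs' := e.continuous.measurable hs
  rw [Measure.map_apply e.continuous.measurable hs, gammaC, withDensity_apply _ hs,
    withDensity_apply _ hs', ← e.measurePreserving.setLIntegral_comp_preimage hs (by fun_prop)]
  simp

open Polynomial in
theorem roots_comp_C_mul_X {R : ℂ} (hR : R ≠ 0) (p : ℂ[X]) :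
    (p.comp (C R * X)).roots = p.roots.map fun a => R⁻¹ * a := by
  have h := roots_comp_C_mul_X_add_C p R 0 hR.isUnit
  simpa using h

open Polynomial in
theorem leadingCoeff_mul_prod_max_le {p : ℂ[X]} {R : ℝ} (hR : 0 < R) :
    ‖p.leadingCoeff‖ * R ^ p.natDegree * (p.roots.map fun a => max 1 (‖a‖ / R)).prod ≤
      ∑ j ∈ Finset.range (p.natDegree + 1), ‖p.coeff j‖ * R ^ j := by
  have hR' : (R : ℂ) ≠ 0 := by exact_mod_cast hR.ne'
  have hd : (p.comp (C (R : ℂ) * X)).natDegree = p.natDegree := by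
    rw [natDegree_comp, natDegree_C_mul_X _ hR', mul_one]
  have h := mahlerMeasure_le_sum_norm_coeff (p.comp (C (R : ℂ) * X))
  rw [mahlerMeasure_eq_leadingCoeff_mul_prod_roots, roots_comp_C_mul_X hR',
    leadingCoeff_comp (by rw [natDegree_C_mul_X _ hR']; exact one_ne_zero),
    sum_over_range _ (by simp), hd, Multiset.map_map] at h
  simpa [abs_of_pos hR, div_eq_inv_mul] using h

theorem Multiset.pow_countP_le_prod {α : Type*} (s : Multiset α) (P : α → Prop) [DecidablePred P]
    {t : ℝ} (ht : 0 ≤ t) {g : α → ℝ} (hg : ∀ a, 0 ≤ g a) (h1 : ∀ a, P a → t ≤ g a)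
    (h2 : ∀ a, ¬ P a → 1 ≤ g a) : t ^ s.countP P ≤ (s.map g).prod := by
  induction s using Multiset.induction with
  | empty => simp
  | cons a s ih =>
    rw [Multiset.map_cons, Multiset.prod_cons]
    by_cases ha : P a
    · rw [Multiset.countP_cons_of_pos _ ha, pow_succ']
      exact mul_le_mul (h1 a ha) ih (by positivity) (hg a)
    · rw [Multiset.countP_cons_of_neg _ ha, ← one_mul (t ^ _)]
      exact mul_le_mul (h2 a ha) ih (by positivity) (hg a)

theorem Multiset.pow_countP_mul_prod_le_prod {α : Type*} (s : Multiset α) (P : α → Prop)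
    [DecidablePred P] {t : ℝ} (ht : 0 ≤ t) {f g : α → ℝ} (hf : ∀ a, 0 ≤ f a) (hg : ∀ a, 0 ≤ g a)
    (h1 : ∀ a, P a → t * f a ≤ g a) (h2 : ∀ a, ¬ P a → f a ≤ g a) :
    t ^ s.countP P * (s.map f).prod ≤ (s.map g).prod := by
  induction s using Multiset.induction with
  | empty => simp
  | cons a s ih =>
    have hs : 0 ≤ (s.map f).prod := Multiset.prod_map_nonneg fun a _ => hf a
    simp only [Multiset.map_cons, Multiset.prod_cons]
    by_cases ha : P a
    · rw [Multiset.countP_cons_of_pos _ ha, pow_succ', mul_mul_mul_comm]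
      exact mul_le_mul (h1 a ha) ih (by positivity) (hg a)
    · rw [Multiset.countP_cons_of_neg _ ha, mul_left_comm]
      exact mul_le_mul (h2 a ha) ih (by positivity) (hg a)

theorem mul_log_inv_le_of_mul_pow_le {K : ℕ} {R x S : ℝ} (hR : 0 < R) (hx : 0 < x)
    (h : x * R⁻¹ ^ K ≤ S) : K * Real.log R⁻¹ ≤ S + x⁻¹ := by
  have hS : 0 < S := lt_of_lt_of_le (by positivity) h
  have h1 := Real.log_le_log (by positivity) h
  rw [Real.log_mul hx.ne' (by positivity), Real.log_pow] at h1
  have h2 := Real.log_le_self hS.le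
  have h3 := Real.log_le_self (inv_pos.2 hx).le
  rw [Real.log_inv] at h3
  linarith

open Polynomial in
theorem countP_norm_le_mul_log_le {p : ℂ[X]} {R : ℝ} (hR : 0 < R) (hp : p.coeff 0 ≠ 0) :
    (p.roots.countP fun a => ‖a‖ ≤ R ^ 2 : ℕ) * Real.log R⁻¹ ≤
      (∑ j ∈ Finset.range (p.natDegree + 1), ‖p.coeff j‖ * R ^ j) + ‖p.coeff 0‖⁻¹ := by
  refine mul_log_inv_le_of_mul_pow_le hR (norm_pos_iff.2 hp)
    (le_trans ?_ (leadingCoeff_mul_prod_max_le hR))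
  have hs := IsAlgClosed.splits p
  have h0 : ‖p.coeff 0‖ = ‖p.leadingCoeff‖ * R ^ p.natDegree *
      (p.roots.map fun a => ‖a‖ / R).prod := by
    have h1 : (p.roots.map fun a => ‖a‖ / R).prod = ‖p.roots.prod‖ / R ^ p.natDegree := by
      rw [hs.natDegree_eq_card_roots, Multiset.prod_map_div, Multiset.map_const',
        Multiset.prod_replicate]
      congr 1
      exact (map_multiset_prod (normHom : ℂ →*₀ ℝ) p.roots).symm
    rw [h1, hs.coeff_zero_eq_leadingCoeff_mul_prod_roots]
    simp only [norm_mul, norm_pow, norm_neg, norm_one, one_pow, one_mul]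
    field_simp
  rw [h0, mul_assoc]
  refine mul_le_mul_of_nonneg_left ?_ (by positivity)
  rw [mul_comm]
  refine Multiset.pow_countP_mul_prod_le_prod _ _ (by positivity) (fun a => by positivity)
    (fun a => by positivity) (fun a ha => le_max_of_le_left ?_) fun a _ => le_max_right _ _
  rw [← div_eq_inv_mul, div_div, div_le_one (by positivity), ← sq]
  exact ha

open Polynomial in
theorem countP_le_norm_mul_log_le {p : ℂ[X]} {R : ℝ} (hR : 0 < R) (hp : p ≠ 0) :
    (p.roots.countP fun a => (R ^ 2)⁻¹ ≤ ‖a‖ : ℕ) * Real.log R⁻¹ ≤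
      (∑ j ∈ Finset.range (p.natDegree + 1), ‖p.coeff j‖ * R ^ (p.natDegree - j)) +
        ‖p.leadingCoeff‖⁻¹ := by
  refine mul_log_inv_le_of_mul_pow_le hR (by simpa using hp) ?_
  have h := leadingCoeff_mul_prod_max_le (p := p) (inv_pos.2 hR)
  have h2 := mul_le_mul_of_nonneg_left h (pow_nonneg hR.le p.natDegree)
  rw [Finset.mul_sum, inv_pow, mul_comm ‖p.leadingCoeff‖, mul_assoc,
    mul_inv_cancel_left₀ (by positivity)] at h2
  have h3 : ∑ j ∈ Finset.range (p.natDegree + 1), R ^ p.natDegree * (‖p.coeff j‖ * R⁻¹ ^ j) =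
      ∑ j ∈ Finset.range (p.natDegree + 1), ‖p.coeff j‖ * R ^ (p.natDegree - j) := by
    refine Finset.sum_congr rfl fun j hj => ?_
    rw [pow_sub₀ _ hR.ne' (Nat.lt_succ_iff.1 (Finset.mem_range.1 hj)), inv_pow]
    ring
  rw [h3] at h2
  refine le_trans (mul_le_mul_of_nonneg_left ?_ (norm_nonneg _)) h2
  refine Multiset.pow_countP_le_prod _ _ (by positivity) (fun a => by positivity)
    (fun a ha => le_max_of_le_right ?_) fun a _ => le_max_left _ _
  rw [div_inv_eq_mul]
  calc R⁻¹ = (R ^ 2)⁻¹ * R := by field_simp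
    _ ≤ _ := by gcongr

theorem Multiset.abs_sum_map_le {α : Type*} (s : Multiset α) {P Q : α → Prop} [DecidablePred P]
    [DecidablePred Q] {g : α → ℝ} {ε M : ℝ} (hε : 0 ≤ ε) (hM : ∀ a, |g a| ≤ M)
    (h : ∀ a, ¬ P a → ¬ Q a → |g a| ≤ ε) :
    |(s.map g).sum| ≤ ε * s.card + M * (s.countP P + s.countP Q) := by
  induction s using Multiset.induction with
  | empty => simp
  | cons a s ih =>
    have hM0 : 0 ≤ M := (abs_nonneg _).trans (hM a)
    have h1 : |g a| ≤ ε + M * ((if P a then 1 else 0) + if Q a then 1 else 0) := by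
      have h2 := hM a
      split_ifs with hP hQ hQ
      · linarith
      · linarith
      · linarith
      · linarith [h a hP hQ]
    rw [Multiset.map_cons, Multiset.sum_cons, Multiset.card_cons, Multiset.countP_cons,
      Multiset.countP_cons]
    push_cast
    linarith [abs_add_le (g a) (s.map g).sum]

open Polynomial in
theorem kac_coeff {N : ℕ} (c : Fin (N + 1) → ℂ) (k : ℕ) :
    (∑ j : Fin (N + 1), c j • (X ^ (j : ℕ) : ℂ[X])).coeff k =
      if h : k < N + 1 then c ⟨k, h⟩ else 0 := by
  simp only [finsetSum_coeff, coeff_smul, coeff_X_pow, smul_eq_mul, mul_ite, mul_one, mul_zero]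
  split_ifs with h
  · rw [Finset.sum_eq_single ⟨k, h⟩] <;> simp +contextual [Fin.ext_iff, eq_comm]
  · exact Finset.sum_eq_zero fun j _ => if_neg (by have := j.2; omega)

open Polynomial in
theorem kac_natDegree_le {N : ℕ} (c : Fin (N + 1) → ℂ) :
    (∑ j : Fin (N + 1), c j • (X ^ (j : ℕ) : ℂ[X])).natDegree ≤ N :=
  natDegree_le_iff_coeff_eq_zero.2 fun k hk => by rw [kac_coeff, dif_neg (by omega)]

open Polynomial in
theorem kac_natDegree {N : ℕ} {c : Fin (N + 1) → ℂ} (hc : c (Fin.last N) ≠ 0) :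
    (∑ j : Fin (N + 1), c j • (X ^ (j : ℕ) : ℂ[X])).natDegree = N :=
  natDegree_eq_of_le_of_coeff_ne_zero (kac_natDegree_le c) <| by
    rw [kac_coeff, dif_pos (by omega)]; exact hc

open Polynomial in
theorem kac_comp_C_mul_X {N : ℕ} (c : Fin (N + 1) → ℂ) (w : ℂ) :
    (∑ j : Fin (N + 1), c j • (X ^ (j : ℕ) : ℂ[X])).comp (C w * X) =
      ∑ j : Fin (N + 1), (w ^ (j : ℕ) * c j) • (X ^ (j : ℕ) : ℂ[X]) := by
  rw [sum_comp]
  refine Finset.sum_congr rfl fun j _ => ?_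
  rw [smul_comp, X_pow_comp, mul_pow, ← C_pow, ← smul_eq_C_mul, smul_smul, mul_comm]

open Polynomial in
theorem kac_eq_of_natDegree_le {N : ℕ} {p : ℂ[X]} (hp : p.natDegree ≤ N) :
    ∑ j : Fin (N + 1), p.coeff j • (X ^ (j : ℕ) : ℂ[X]) = p := by
  ext k
  rw [kac_coeff (fun j : Fin (N + 1) => p.coeff j)]
  split_ifs with h
  · rfl
  · exact (coeff_eq_zero_of_natDegree_lt (by omega)).symm

open Polynomial in
theorem continuous_coeff_prod_X_sub_C {ι : Type*} (s : Finset ι) (k : ℕ) :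
    Continuous fun a : ι → ℂ => (∏ i ∈ s, (X - C (a i))).coeff k := by
  classical
  induction s using Finset.induction generalizing k with
  | empty => simpa using continuous_const
  | insert i s hi ih =>
    simp only [Finset.prod_insert hi, sub_mul, coeff_sub, coeff_C_mul]
    refine Continuous.sub ?_ ((continuous_apply i).mul (ih k))
    cases k with
    | zero => simpa using continuous_const
    | succ k => simpa only [coeff_X_mul] using ih k

theorem Multiset.exists_fin_map_univ_eq {α : Type*} (s : Multiset α) {n : ℕ} (hn : s.card = n) :
    ∃ a : Fin n → α, s = Finset.univ.val.map a := by
  subst hn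
  induction s using Quotient.inductionOn with
  | h l =>
    exact ⟨l.get, show (l : Multiset α) = Multiset.map l.get Finset.univ.val by
      rw [Fin.univ_val_map, List.ofFn_get]⟩

open Polynomial in
theorem measurable_indicator_sum_roots (N : ℕ) {φ : ℂ → ℝ} (hφ : Measurable φ) :
    Measurable ({c : EuclideanSpace ℂ (Fin (N + 1)) | c (Fin.last N) ≠ 0}.indicator fun c =>
      ((∑ j : Fin (N + 1), c j • (X ^ (j : ℕ) : ℂ[X])).roots.map φ).sum) := by
  set S := {c : EuclideanSpace ℂ (Fin (N + 1)) | c (Fin.last N) ≠ 0}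
  set F := fun c : EuclideanSpace ℂ (Fin (N + 1)) =>
      ((∑ j : Fin (N + 1), c j • (X ^ (j : ℕ) : ℂ[X])).roots.map φ).sum
  have hS : MeasurableSet S := (isOpen_ne_fun (by fun_prop) continuous_const).measurableSet
  let q : ℂ × (Fin N → ℂ) → ℂ[X] := fun x => C (Complex.exp x.1) * ∏ i, (X - C (x.2 i))
  have hqm (a : Fin N → ℂ) : (∏ i, (X - C (a i))).Monic := monic_prod_X_sub_C _ _
  have hqd (x) : (q x).natDegree = N := by
    rw [natDegree_C_mul (Complex.exp_ne_zero _), natDegree_finsetProd_X_sub_C_eq_card]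
    simp
  have hql (x) : (q x).coeff N ≠ 0 := by
    have h := (hqm x.2).coeff_natDegree
    rw [natDegree_finsetProd_X_sub_C_eq_card, Finset.card_univ, Fintype.card_fin] at h
    rw [coeff_C_mul, h, mul_one]
    exact Complex.exp_ne_zero _
  let f : ℂ × (Fin N → ℂ) → EuclideanSpace ℂ (Fin (N + 1)) := fun x =>
    WithLp.toLp 2 fun j => (q x).coeff j
  have hfm : Measurable f := by
    refine Continuous.measurable ((PiLp.continuous_toLp 2 _).comp (continuous_pi fun j => ?_))
    simp only [q, coeff_C_mul]
    exact (Complex.continuous_exp.comp continuous_fst).mul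
      ((continuous_coeff_prod_X_sub_C Finset.univ j).comp continuous_snd)
  have hFf (x) : F (f x) = ∑ i, φ (x.2 i) := by
    have hm : Multiset.map (fun i => X - C (x.2 i)) Finset.univ.val =
        (Finset.univ.val.map x.2).map fun a => X - C a := by
      rw [Multiset.map_map]
      rfl
    simp only [F, f]
    rw [kac_eq_of_natDegree_le (hqd x).le, roots_C_mul _ (Complex.exp_ne_zero _), Finset.prod,
      hm, roots_multiset_prod_X_sub_C, Multiset.map_map]
    rfl
  have hrange : Set.range f = S := by
    ext c
    constructor
    · rintro ⟨x, rfl⟩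
      exact hql x
    · intro hc
      have hd := kac_natDegree hc
      have hs := IsAlgClosed.splits (∑ j : Fin (N + 1), c j • (X ^ (j : ℕ) : ℂ[X]))
      obtain ⟨a, ha⟩ := Multiset.exists_fin_map_univ_eq _
        (hs.natDegree_eq_card_roots.symm.trans hd)
      have hlead : (∑ j : Fin (N + 1), c j • (X ^ (j : ℕ) : ℂ[X])).leadingCoeff =
          c (Fin.last N) := by
        rw [leadingCoeff, hd, kac_coeff, dif_pos (by omega)]
        rfl
      have hq : q (Complex.log (c (Fin.last N)), a) =
          ∑ j : Fin (N + 1), c j • (X ^ (j : ℕ) : ℂ[X]) := by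
        conv_rhs => rw [hs.eq_prod_roots, hlead, ha, Multiset.map_map]
        simp only [q, Complex.exp_log hc]
        rfl
      refine ⟨(Complex.log (c (Fin.last N)), a), ?_⟩
      ext j
      simp only [f, hq]
      rw [kac_coeff, dif_pos j.2]
  have hFS : Measurable (S.domRestrict F) := by
    rw [← hrange]
    refine hfm.measurable_comp_iff_restrict.1 ?_
    have : F ∘ f = fun x => ∑ i, φ (x.2 i) := funext hFf
    rw [this]
    fun_prop
  refine measurable_of_restrict_of_restrict_compl hS ?_ ?_
  · convert hFS using 1
    ext c
    exact Set.indicator_of_mem c.2 _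
  · convert (measurable_const : Measurable fun _ : (Sᶜ : Set _) => (0 : ℝ)) using 1
    ext c
    exact Set.indicator_of_notMem c.2 _

theorem integral_sum_roots_rotate (N : ℕ) (φ : ℂ → ℝ) (u : Circle) :
    ∫ c, ((∑ j : Fin (N + 1), c j • (Polynomial.X ^ (j : ℕ) : Polynomial ℂ)).roots.map
        fun z => φ (u * z)).sum ∂gammaC (N + 1) =
      ∫ c, ((∑ j : Fin (N + 1), c j • (Polynomial.X ^ (j : ℕ) : Polynomial ℂ)).roots.map
        φ).sum ∂gammaC (N + 1) := by
  let e : EuclideanSpace ℂ (Fin (N + 1)) ≃ₗᵢ[ℝ] EuclideanSpace ℂ (Fin (N + 1)) :=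
    LinearIsometryEquiv.piLpCongrRight 2 fun j => rotation (u⁻¹ ^ (j : ℕ))
  rw [← (measurePreserving_gammaC e).integral_comp e.toHomeomorph.measurableEmbedding fun c =>
    ((∑ j : Fin (N + 1), c j • (Polynomial.X ^ (j : ℕ) : Polynomial ℂ)).roots.map φ).sum]
  congr with c
  have h := kac_comp_C_mul_X c.ofLp ((u : ℂ)⁻¹)
  have he : ∀ j, e c j = (u : ℂ)⁻¹ ^ (j : ℕ) * c j := fun j => by
    simp only [e, LinearIsometryEquiv.piLpCongrRight_apply, rotation_apply]
    simp
  simp_rw [he]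
  rw [← h, roots_comp_C_mul_X (inv_ne_zero u.coe_ne_zero), Multiset.map_map]
  simp

/-- The rotational average of `φ` over the circle through `z` centred at the origin. -/
noncomputable def rotationAverage (φ : ℂ → ℝ) (z : ℂ) : ℝ :=
  (2 * Real.pi)⁻¹ * ∫ θ in (0 : ℝ)..(2 * Real.pi), φ (Complex.exp ((θ : ℂ) * Complex.I) * z)

theorem rotationAverage_eq_norm (φ : ℂ → ℝ) (z : ℂ) :
    rotationAverage φ z = rotationAverage φ ‖z‖ := by
  have hper : Function.Periodic
      (fun θ : ℝ => φ (Complex.exp ((θ : ℂ) * Complex.I) * ‖z‖)) (2 * Real.pi) := fun θ => by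
    simp [add_mul, Complex.exp_add]
  have h1 : ∀ θ : ℝ, φ (Complex.exp ((θ : ℂ) * Complex.I) * z) =
      φ (Complex.exp (((θ + z.arg : ℝ) : ℂ) * Complex.I) * ‖z‖) := fun θ => by
    conv_lhs => rw [← Complex.norm_mul_exp_arg_mul_I z]
    push_cast
    rw [add_mul, Complex.exp_add]
    ring_nf
  unfold rotationAverage
  simp_rw [h1]
  rw [intervalIntegral.integral_comp_add_right
    (fun θ : ℝ => φ (Complex.exp ((θ : ℂ) * Complex.I) * ‖z‖)), zero_add, add_comm,
    hper.intervalIntegral_add_eq z.arg 0, zero_add]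

theorem abs_rotationAverage_sub_le {φ : ℂ → ℝ} (hφ : Continuous φ) {z w : ℂ} {C : ℝ}
    (h : ∀ θ : ℝ, |φ (Complex.exp ((θ : ℂ) * Complex.I) * z) -
      φ (Complex.exp ((θ : ℂ) * Complex.I) * w)| ≤ C) :
    |rotationAverage φ z - rotationAverage φ w| ≤ C := by
  unfold rotationAverage
  rw [← mul_sub, ← intervalIntegral.integral_sub (Continuous.intervalIntegrable (by fun_prop) _ _)
    (Continuous.intervalIntegrable (by fun_prop) _ _), abs_mul, abs_of_pos (by positivity),
    inv_mul_le_iff₀ (by positivity)]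
  have := intervalIntegral.norm_integral_le_of_norm_le_const (a := 0) (b := 2 * Real.pi)
    (f := fun θ : ℝ => φ (Complex.exp ((θ : ℂ) * Complex.I) * z) -
      φ (Complex.exp ((θ : ℂ) * Complex.I) * w)) (C := C) fun θ _ => h θ
  rwa [sub_zero, abs_of_pos Real.two_pi_pos, mul_comm C] at this

theorem intervalIntegral_multiset_sum {α : Type*} (s : Multiset α) {f : α → ℝ → ℝ} {a b : ℝ}
    (hf : ∀ x, Continuous (f x)) :
    Continuous (fun t => (s.map fun x => f x t).sum) ∧
    ∫ t in a..b, (s.map fun x => f x t).sum = (s.map fun x => ∫ t in a..b, f x t).sum := by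
  induction s using Multiset.induction with
  | empty => simpa using continuous_const
  | cons x s ih =>
    simp only [Multiset.map_cons, Multiset.sum_cons]
    refine ⟨(hf x).add ih.1, ?_⟩
    rw [intervalIntegral.integral_add ((hf x).intervalIntegrable _ _)
      (ih.1.intervalIntegrable _ _), ih.2]

theorem abs_multiset_sum_le {α : Type*} (s : Multiset α) {f : α → ℝ} {M : ℝ}
    (h : ∀ x, |f x| ≤ M) : |(s.map f).sum| ≤ s.card * M := by
  induction s using Multiset.induction with
  | empty => simp
  | cons x s ih =>
    simp only [Multiset.map_cons, Multiset.sum_cons, Multiset.card_cons, Nat.cast_add, Nat.cast_one]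
    linarith [abs_add_le (f x) (s.map f).sum, h x]

theorem aestronglyMeasurable_sum_roots (N : ℕ) {φ : ℂ → ℝ} (hφ : Measurable φ) :
    AEStronglyMeasurable (fun c : EuclideanSpace ℂ (Fin (N + 1)) =>
      ((∑ j : Fin (N + 1), c j • (Polynomial.X ^ (j : ℕ) : Polynomial ℂ)).roots.map φ).sum)
      (gammaC (N + 1)) := by
  refine (measurable_indicator_sum_roots N hφ).aestronglyMeasurable.congr ?_
  filter_upwards [ae_gammaC_apply_ne_zero (Fin.last N)] with c hc
  exact Set.indicator_of_mem (s := {c : EuclideanSpace ℂ (Fin (N + 1)) | c (Fin.last N) ≠ 0}) hc _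

theorem abs_sum_roots_le {N : ℕ} (c : Fin (N + 1) → ℂ) {φ : ℂ → ℝ} {M : ℝ} (hM : ∀ z, |φ z| ≤ M) :
    |((∑ j : Fin (N + 1), c j • (Polynomial.X ^ (j : ℕ) : Polynomial ℂ)).roots.map φ).sum| ≤
      N * M :=
  (abs_multiset_sum_le _ hM).trans <| mul_le_mul_of_nonneg_right
    (mod_cast (Polynomial.card_roots' _).trans (kac_natDegree_le c)) ((abs_nonneg _).trans (hM 0))

theorem integral_sum_roots_eq_rotationAverage (N : ℕ) {φ : ℂ → ℝ} (hφ : Continuous φ) {M : ℝ}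
    (hM : ∀ z, |φ z| ≤ M) :
    ∫ c, ((∑ j : Fin (N + 1), c j • (Polynomial.X ^ (j : ℕ) : Polynomial ℂ)).roots.map
        φ).sum ∂gammaC (N + 1) =
      ∫ c, ((∑ j : Fin (N + 1), c j • (Polynomial.X ^ (j : ℕ) : Polynomial ℂ)).roots.map
        (rotationAverage φ)).sum ∂gammaC (N + 1) := by
  set S := {c : EuclideanSpace ℂ (Fin (N + 1)) | c (Fin.last N) ≠ 0} with hS
  have hae : ∀ᵐ c ∂gammaC (N + 1), c ∈ S := ae_gammaC_apply_ne_zero (Fin.last N)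
  let φr : ℝ → ℂ → ℝ := fun θ z => φ (Complex.exp ((θ : ℂ) * Complex.I) * z)
  let G : ℝ → EuclideanSpace ℂ (Fin (N + 1)) → ℝ := fun θ => S.indicator fun c =>
    ((∑ j : Fin (N + 1), c j • (Polynomial.X ^ (j : ℕ) : Polynomial ℂ)).roots.map (φr θ)).sum
  have hsum (c : EuclideanSpace ℂ (Fin (N + 1))) := intervalIntegral_multiset_sum
    (∑ j : Fin (N + 1), c j • (Polynomial.X ^ (j : ℕ) : Polynomial ℂ)).roots
    (f := fun z θ => φr θ z) (a := 0) (b := 2 * Real.pi) fun z => by fun_prop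
  have hGm : Measurable (Function.uncurry G) := by
    refine measurable_uncurry_of_continuous_of_measurable (fun c => ?_) fun θ =>
      measurable_indicator_sum_roots N (by fun_prop)
    by_cases hc : c ∈ S
    · simpa only [G, Set.indicator_of_mem hc] using (hsum c).1
    · simpa only [G, Set.indicator_of_notMem hc] using continuous_const
  have hGb (θ c) : ‖G θ c‖ ≤ N * M := by
    refine (norm_indicator_le_norm_self _ _).trans ?_
    exact abs_sum_roots_le _ fun z => hM _
  have : IsFiniteMeasure (volume.restrict (Set.uIoc 0 (2 * Real.pi))) :=
    ⟨by rw [Measure.restrict_apply_univ, Set.uIoc]; exact measure_Ioc_lt_top⟩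
  have hswap := intervalIntegral_integral_swap (f := G) (μ := gammaC (N + 1))
    (a := 0) (b := 2 * Real.pi) (.of_bound hGm.aestronglyMeasurable (N * M) 
      (.of_forall fun x => hGb _ _))
  have h1 (θ : ℝ) : ∫ c, G θ c ∂gammaC (N + 1) =
      ∫ c, ((∑ j : Fin (N + 1), c j • (Polynomial.X ^ (j : ℕ) : Polynomial ℂ)).roots.map
        φ).sum ∂gammaC (N + 1) := by
    rw [← integral_sum_roots_rotate N φ (Circle.exp θ)]
    refine integral_congr_ae ?_
    filter_upwards [hae] with c hc
    simp only [G, Set.indicator_of_mem hc, φr, Circle.coe_exp]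
  have h2 : ∫ c, (∫ θ in (0 : ℝ)..(2 * Real.pi), G θ c) ∂gammaC (N + 1) = 2 * Real.pi *
      ∫ c, ((∑ j : Fin (N + 1), c j • (Polynomial.X ^ (j : ℕ) : Polynomial ℂ)).roots.map
        (rotationAverage φ)).sum ∂gammaC (N + 1) := by
    rw [← integral_const_mul]
    refine integral_congr_ae ?_
    filter_upwards [hae] with c hc
    simp only [G, Set.indicator_of_mem hc]
    rw [(hsum c).2, ← Multiset.sum_map_mul_left]
    congr with z
    simp only [rotationAverage, φr]
    rw [mul_inv_cancel_left₀ Real.two_pi_pos.ne']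
  rw [h2] at hswap
  simp_rw [h1] at hswap
  rw [intervalIntegral.integral_const, sub_zero, smul_eq_mul] at hswap
  exact mul_left_cancel₀ Real.two_pi_pos.ne' hswap

theorem continuous_rotationAverage {φ : ℂ → ℝ} (hφ : Continuous φ) :
    Continuous (rotationAverage φ) :=
  continuous_const.mul <| intervalIntegral.continuous_parametric_intervalIntegral_of_continuous'
    (f := fun (z : ℂ) (θ : ℝ) => φ (Complex.exp ((θ : ℂ) * Complex.I) * z)) (by fun_prop) _ _

theorem sum_fin_pow_le {R : ℝ} (hR : 0 < R) (hR1 : R < 1) (n : ℕ) :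
    ∑ j : Fin n, R ^ (j : ℕ) ≤ (1 - R)⁻¹ := by
  rw [Fin.sum_univ_eq_sum_range fun j => R ^ j, ← tsum_geometric_of_lt_one hR.le hR1]
  exact (summable_geometric_of_lt_one hR.le hR1).sum_le_tsum _ fun j _ => by positivity

theorem sum_fin_pow_sub_le {R : ℝ} (hR : 0 < R) (hR1 : R < 1) (N : ℕ) :
    ∑ j : Fin (N + 1), R ^ (N - (j : ℕ)) ≤ (1 - R)⁻¹ := by
  refine le_trans (le_of_eq ?_) (sum_fin_pow_le hR hR1 (N + 1))
  rw [← Equiv.sum_comp Fin.revPerm fun j : Fin (N + 1) => R ^ (j : ℕ)]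
  refine Finset.sum_congr rfl fun j _ => ?_
  simp [Fin.val_rev]

/-- The bound for the weighted coefficient sums is uniform in the number of coefficients. -/
theorem exists_integral_weighted_sum_le (D : ℝ) :
    ∃ K : ℝ, ∀ (n : ℕ) (k : Fin n) (w : Fin n → ℝ), ∑ j, w j ≤ D →
      Integrable (fun c => ∑ j, ‖c j‖ * w j + ‖c k‖⁻¹) (gammaC n) ∧
      ∫ c, (∑ j, ‖c j‖ * w j + ‖c k‖⁻¹) ∂gammaC n ≤ K := by
  have h1 : Integrable fun z : ℂ => Real.exp (-‖z‖ ^ 2) * ‖z‖ := by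
    simpa using integrable_exp_neg_sq_norm_mul_norm_rpow (q := 1) (by norm_num)
  have h2 : Integrable fun z : ℂ => Real.exp (-‖z‖ ^ 2) * ‖z‖⁻¹ := by
    simpa [Real.rpow_neg_one] using
      integrable_exp_neg_sq_norm_mul_norm_rpow (q := -1) (by norm_num)
  have hK : 0 ≤ Real.pi⁻¹ * ∫ z : ℂ, Real.exp (-‖z‖ ^ 2) * ‖z‖ :=
    mul_nonneg (by positivity) (integral_nonneg fun z => by positivity)
  refine ⟨(Real.pi⁻¹ * ∫ z : ℂ, Real.exp (-‖z‖ ^ 2) * ‖z‖) * D +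
    Real.pi⁻¹ * ∫ z : ℂ, Real.exp (-‖z‖ ^ 2) * ‖z‖⁻¹, fun n k w hw => ?_⟩
  have hi1 (j : Fin n) : Integrable (fun c => ‖c j‖ * w j) (gammaC n) :=
    (integrable_comp_apply_gammaC j h1).mul_const _
  have hi2 : Integrable (fun c => ‖c k‖⁻¹) (gammaC n) :=
    integrable_comp_apply_gammaC (g := fun z => ‖z‖⁻¹) k h2
  have hs := integrable_finsetSum Finset.univ fun j _ => hi1 j
  refine ⟨hs.add hi2, ?_⟩
  rw [integral_add hs hi2, integral_finsetSum _ fun j _ => hi1 j,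
    integral_comp_apply_gammaC k fun z => ‖z‖⁻¹]
  gcongr
  simp_rw [integral_mul_const, integral_comp_apply_gammaC _ fun z => ‖z‖, ← Finset.mul_sum]
  gcongr

theorem exists_annulus {δ : ℝ} (hδ : 0 < δ) :
    ∃ R : ℝ, 0 < R ∧ R < 1 ∧ 1 - δ < R ^ 2 ∧ (R ^ 2)⁻¹ < 1 + δ := by
  have h1 : Filter.Tendsto (fun R : ℝ => R ^ 2) (nhdsWithin 1 (Set.Iio 1)) (nhds 1) := by
    have : ContinuousAt (fun R : ℝ => R ^ 2) 1 := by fun_prop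
    simpa using this.tendsto.mono_left nhdsWithin_le_nhds
  have h2 : Filter.Tendsto (fun R : ℝ => (R ^ 2)⁻¹) (nhdsWithin 1 (Set.Iio 1)) (nhds 1) := by
    simpa using h1.inv₀ one_ne_zero
  have h3 : ∀ᶠ R : ℝ in nhdsWithin 1 (Set.Iio 1), 0 < R :=
    nhdsWithin_le_nhds (lt_mem_nhds one_pos)
  have h4 : ∀ᶠ R : ℝ in nhdsWithin 1 (Set.Iio 1), R < 1 := self_mem_nhdsWithin
  obtain ⟨R, h⟩ := (h3.and (h4.and
    ((h1.eventually (lt_mem_nhds (show 1 - δ < 1 by linarith))).and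
      (h2.eventually (gt_mem_nhds (show 1 < 1 + δ by linarith)))))).exists
  exact ⟨R, h⟩

theorem abs_sum_roots_sub_le {N : ℕ} {c : Fin (N + 1) → ℂ} (h0 : c 0 ≠ 0)
    (hN : c (Fin.last N) ≠ 0) {R : ℝ} (hR : 0 < R) (hR1 : R < 1) {ψ : ℂ → ℝ} {A ε M : ℝ}
    (hε : 0 ≤ ε) (hM : ∀ z, |ψ z - A| ≤ M)
    (h : ∀ z, R ^ 2 < ‖z‖ → ‖z‖ < (R ^ 2)⁻¹ → |ψ z - A| ≤ ε) :
    |((∑ j : Fin (N + 1), c j • (Polynomial.X ^ (j : ℕ) : Polynomial ℂ)).roots.map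
      ψ).sum - N * A| ≤
      ε * N + M * (Real.log R⁻¹)⁻¹ * ((∑ j, ‖c j‖ * R ^ (j : ℕ) + ‖c 0‖⁻¹) +
        (∑ j, ‖c j‖ * R ^ (N - (j : ℕ)) + ‖c (Fin.last N)‖⁻¹)) := by
  set p := ∑ j : Fin (N + 1), c j • (Polynomial.X ^ (j : ℕ) : Polynomial ℂ) with hp
  have hM0 : 0 ≤ M := (abs_nonneg _).trans (hM 0)
  have hL : 0 < Real.log R⁻¹ := Real.log_pos ((one_lt_inv₀ hR).2 hR1)
  have hd : p.natDegree = N := kac_natDegree hN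
  have hcoeff (j : Fin (N + 1)) : p.coeff j = c j := by rw [hp, kac_coeff, dif_pos j.2]
  have hcoeff0 : p.coeff 0 = c 0 := hcoeff 0
  have hlead : p.leadingCoeff = c (Fin.last N) := by
    rw [Polynomial.leadingCoeff, hd]; exact hcoeff (Fin.last N)
  have hcard : p.roots.card = N := by
    rw [← hd, (IsAlgClosed.splits p).natDegree_eq_card_roots]
  have hne : p ≠ 0 := fun h => hN (by rw [← hlead, h, Polynomial.leadingCoeff_zero])
  have b1 := countP_norm_le_mul_log_le (p := p) hR (hcoeff0 ▸ h0)
  have b2 := countP_le_norm_mul_log_le (p := p) hR hne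
  rw [hd, ← Fin.sum_univ_eq_sum_range fun j => ‖p.coeff j‖ * R ^ j, hcoeff0] at b1
  rw [hd, ← Fin.sum_univ_eq_sum_range fun j => ‖p.coeff j‖ * R ^ (N - j), hlead] at b2
  simp_rw [hcoeff] at b1 b2
  have hsub : (p.roots.map ψ).sum - N * A = (p.roots.map fun z => ψ z - A).sum := by
    rw [Multiset.sum_map_sub, Multiset.map_const', Multiset.sum_replicate, hcard, nsmul_eq_mul]
  rw [hsub]
  refine (Multiset.abs_sum_map_le p.roots (P := fun a => ‖a‖ ≤ R ^ 2)
    (Q := fun a => (R ^ 2)⁻¹ ≤ ‖a‖) hε hM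
    fun z h1 h2 => h z (not_le.1 h1) (not_le.1 h2)).trans ?_
  rw [hcard, mul_assoc M]
  gcongr
  rw [← div_eq_inv_mul, le_div_iff₀ hL, add_mul]
  exact add_le_add b1 b2

theorem abs_integral_sum_roots_sub_le {ψ : ℂ → ℝ} (hψ : Measurable ψ) {A ε B M R : ℝ}
    (hR : 0 < R) (hR1 : R < 1) (hε : 0 ≤ ε) (hB : ∀ z, |ψ z| ≤ B) (hM : ∀ z, |ψ z - A| ≤ M)
    (h : ∀ z, R ^ 2 < ‖z‖ → ‖z‖ < (R ^ 2)⁻¹ → |ψ z - A| ≤ ε) :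
    ∃ K : ℝ, ∀ N : ℕ,
      |∫ c, ((∑ j : Fin (N + 1), c j • (Polynomial.X ^ (j : ℕ) : Polynomial ℂ)).roots.map
        ψ).sum ∂gammaC (N + 1) - N * A| ≤ ε * N + K := by
  obtain ⟨K, hK⟩ := exists_integral_weighted_sum_le (1 - R)⁻¹
  have hM0 : 0 ≤ M := (abs_nonneg _).trans (hM 0)
  have hL : 0 < Real.log R⁻¹ := Real.log_pos ((one_lt_inv₀ hR).2 hR1)
  refine ⟨M * (Real.log R⁻¹)⁻¹ * (K + K), fun N => ?_⟩
  obtain ⟨i1, k1⟩ := hK (N + 1) 0 (fun j => R ^ (j : ℕ)) (sum_fin_pow_le hR hR1 _)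
  obtain ⟨i2, k2⟩ := hK (N + 1) (Fin.last N) (fun j => R ^ (N - (j : ℕ)))
    (sum_fin_pow_sub_le hR hR1 _)
  have hF : Integrable (fun c : EuclideanSpace ℂ (Fin (N + 1)) =>
      ((∑ j : Fin (N + 1), c j • (Polynomial.X ^ (j : ℕ) : Polynomial ℂ)).roots.map ψ).sum)
      (gammaC (N + 1)) :=
    .of_bound (aestronglyMeasurable_sum_roots N hψ) (N * B)
      (.of_forall fun c => abs_sum_roots_le c.ofLp hB)
  have hsub := integral_sub hF (integrable_const (N * A))
  rw [integral_const, probReal_univ, one_smul] at hsub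
  rw [← hsub, ← Real.norm_eq_abs]
  have hi := (integrable_const (μ := gammaC (N + 1)) (ε * N)).add
    ((i1.add i2).const_mul (M * (Real.log R⁻¹)⁻¹))
  refine (norm_integral_le_of_norm_le hi ?_).trans ?_
  · filter_upwards [ae_gammaC_apply_ne_zero (0 : Fin (N + 1)),
      ae_gammaC_apply_ne_zero (Fin.last N)] with c h0 hN
    exact abs_sum_roots_sub_le h0 hN hR hR1 hε hM h
  · rw [integral_add' (integrable_const _) ((i1.add i2).const_mul _), integral_const,
      probReal_univ, one_smul, integral_const_mul, integral_add' i1 i2]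
    gcongr

/-- Expected equidistribution of zeros on the unit circle for the Kac-type ensemble
`f_{N,c}(z) = ∑_{j=0}^N cⱼ zʲ`: for every continuous compactly supported `φ : ℂ → ℝ`,
`(1/N) E[∑_{a ∈ Z(f_{N,c})} φ(a)] → (1/2π) ∫₀^{2π} φ(e^{iθ}) dθ`. -/
theorem kac_expected_equidistribution (φ : ℂ → ℝ)
    (hφ : Continuous φ) (hsupp : HasCompactSupport φ) :
    Filter.Tendsto
      (fun N : ℕ => (N : ℝ)⁻¹ *
        ∫ c : EuclideanSpace ℂ (Fin (N + 1)),
          ((∑ j : Fin (N + 1), c j • (Polynomial.X ^ (j : ℕ) : Polynomial ℂ)).roots.map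
            φ).sum ∂(gammaC (N + 1)))
      Filter.atTop
      (nhds ((2 * Real.pi)⁻¹ *
        ∫ θ in (0 : ℝ)..(2 * Real.pi), φ (Complex.exp ((θ : ℂ) * Complex.I)))) := by
  obtain ⟨B, hB⟩ := hφ.bounded_above_of_compact_support hsupp
  have hunif := hsupp.uniformContinuous_of_continuous hφ
  set A := rotationAverage φ 1 with hA
  have hlim : (2 * Real.pi)⁻¹ *
      ∫ θ in (0 : ℝ)..(2 * Real.pi), φ (Complex.exp ((θ : ℂ) * Complex.I)) = A := by
    simp [hA, rotationAverage]
  rw [hlim, Metric.tendsto_atTop]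
  intro ε hε
  obtain ⟨δ, hδ, hδε⟩ := Metric.uniformContinuous_iff.1 hunif (ε / 2) (by positivity)
  obtain ⟨R, hR, hR1, hRl, hRu⟩ := exists_annulus hδ
  have hdiff (z w : ℂ) : |φ z - φ w| ≤ B + B := (abs_sub _ _).trans (add_le_add (hB z) (hB w))
  have hclose (z : ℂ) (h1 : R ^ 2 < ‖z‖) (h2 : ‖z‖ < (R ^ 2)⁻¹) :
      |rotationAverage φ z - A| ≤ ε / 2 := by
    rw [rotationAverage_eq_norm]
    refine abs_rotationAverage_sub_le hφ fun θ => (hδε ?_).le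
    rw [dist_eq_norm, ← mul_sub, norm_mul, Complex.norm_exp_ofReal_mul_I, one_mul,
      ← Complex.ofReal_one, ← Complex.ofReal_sub, Complex.norm_real, Real.norm_eq_abs, abs_lt]
    constructor <;> linarith
  have hbound (z : ℂ) : |rotationAverage φ z - A| ≤ B + B :=
    abs_rotationAverage_sub_le hφ fun θ => hdiff _ _
  obtain ⟨K, hK⟩ := abs_integral_sum_roots_sub_le (continuous_rotationAverage hφ).measurable
    hR hR1 (half_pos hε).le (B := B + B + |A|)
    (fun z => by linarith [hbound z, abs_sub_abs_le_abs_sub (rotationAverage φ z) A]) hbound hclose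
  obtain ⟨N₀, hN₀⟩ := exists_nat_gt (K / (ε / 2))
  refine ⟨N₀ + 1, fun N hN => ?_⟩
  have hNpos : (0 : ℝ) < N := by exact_mod_cast (show 0 < N by omega)
  have hKN : K < ε / 2 * N := by
    rw [div_lt_iff₀' (by positivity)] at hN₀
    exact hN₀.trans (by gcongr; omega)
  rw [integral_sum_roots_eq_rotationAverage N hφ hB, Real.dist_eq]
  have hle := hK N
  rw [show ∀ x : ℝ, (N : ℝ)⁻¹ * x - A = (N : ℝ)⁻¹ * (x - N * A) from fun x => by field_simp,
    abs_mul, abs_of_pos (inv_pos.2 hNpos), inv_mul_lt_iff₀ hNpos]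
  linarith
end

section
/- (Almost sure equidistribution of zeros on the unit circle; one-variable instance of Theorem 1.4.) Let P = ⊗_{N=1}^∞ γ_{N+1} be the product probability measure on Ω = ∏_{N=1}^∞ ℂ^{N+1}, and for ω = (c^{(N)})_N ∈ Ω set f_N^ω(z) = ∑_{j=0}^N c_j^{(N)} z^j. Then for P-almost every ω ∈ Ω, for every continuous compactly supported function φ : ℂ → ℝ, (1/N) ∑_{a ∈ Z(f_N^ω)} φ(a) → (1/2π) ∫_0^{2π} φ(e^{iθ}) dθ as N → ∞; that is, the normalized counting measures of the zeros of f_N^ω converge weak* to the normalized arclength measure on the unit circle. -/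
open MeasureTheory

lemma circleAverage_zpow {m : ℤ} (hm : m ≠ 0) :
    Real.circleAverage (fun z : ℂ => z ^ m) 0 1 = 0 := by
  rw [Real.circleAverage_eq_circleIntegral one_ne_zero]
  have h : (∮ z in C(0, 1), (z - 0)⁻¹ • z ^ m) = ∮ z in C(0, 1), (z - 0) ^ (m - 1) := by
    refine circleIntegral.integral_congr zero_le_one fun z hz => ?_
    have hz0 : z ≠ 0 := by
      rintro rfl
      simp at hz
    simp [zpow_sub_one₀ hz0, mul_comm]
  rw [h, circleIntegral.integral_sub_zpow_of_ne (by omega), smul_zero]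

lemma circleAverage_hasSum {f : ℕ → ℂ → ℂ} {g : ℂ → ℂ} {b : ℕ → ℝ}
    (hf : ∀ n, ContinuousOn (f n) (Metric.sphere 0 1)) (hb : Summable b)
    (hfb : ∀ n, ∀ z ∈ Metric.sphere (0 : ℂ) 1, ‖f n z‖ ≤ b n)
    (hfg : ∀ z ∈ Metric.sphere (0 : ℂ) 1, HasSum (fun n => f n z) (g z)) :
    HasSum (fun n => Real.circleAverage (f n) 0 1) (Real.circleAverage g 0 1) := by
  have hmem (θ : ℝ) : circleMap 0 1 θ ∈ Metric.sphere (0 : ℂ) 1 :=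
    circleMap_mem_sphere 0 zero_le_one θ
  simp only [Real.circleAverage_def]
  refine HasSum.const_smul _ ?_
  refine intervalIntegral.hasSum_integral_of_dominated_convergence (fun n _ => b n) ?_ ?_ ?_ ?_ ?_
  · intro n
    exact ((hf n).comp_continuous (continuous_circleMap 0 1) hmem).aestronglyMeasurable
  · exact fun n => Filter.Eventually.of_forall fun θ _ => hfb n _ (hmem θ)
  · exact Filter.Eventually.of_forall fun θ _ => hb
  · exact intervalIntegrable_const
  · exact Filter.Eventually.of_forall fun θ _ => hfg _ (hmem θ)

lemma circleAverage_pow_mul_log_norm_sub_of_lt {k : ℕ} (hk : k ≠ 0) {w : ℂ} (hw : ‖w‖ < 1) :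
    Real.circleAverage (fun z : ℂ => z ^ k * (Real.log ‖z - w‖ : ℂ)) 0 1 = -w ^ k / (2 * k) := by
  have h1 : HasSum (fun n : ℕ => Real.circleAverage (fun z : ℂ =>
      (-(w ^ n / (2 * n))) • z ^ ((k : ℤ) - n)
        + (-((starRingEnd ℂ w) ^ n / (2 * n))) • z ^ ((k : ℤ) + n)) 0 1)
      (Real.circleAverage (fun z : ℂ => z ^ k * (Real.log ‖z - w‖ : ℂ)) 0 1) := by
    refine circleAverage_hasSum (b := fun n => ‖w‖ ^ n) ?_
      (summable_geometric_of_lt_one (norm_nonneg _) hw) ?_ ?_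
    · intro n z hz
      have hz0 : z ≠ 0 := by
        rintro rfl
        simp at hz
      simp only [smul_eq_mul]
      exact ((continuousAt_const.mul (continuousAt_zpow₀ _ _ (Or.inl hz0))).add
        (continuousAt_const.mul (continuousAt_zpow₀ _ _ (Or.inl hz0)))).continuousWithinAt
    · intro n z hz
      have hz1 : ‖z‖ = 1 := by simpa using hz
      refine (norm_add_le _ _).trans ?_
      simp only [norm_smul, norm_neg, norm_div, norm_pow, RCLike.norm_conj, norm_zpow, hz1,
        one_zpow, mul_one, norm_mul, Complex.norm_natCast, Complex.norm_ofNat]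
      rcases Nat.eq_zero_or_pos n with rfl | hn
      · simp
      · have : (1 : ℝ) ≤ n := by exact_mod_cast hn
        rw [← add_div, div_le_iff₀ (by positivity)]
        nlinarith [pow_nonneg (norm_nonneg w) n]
    · intro z hz
      have hz1 : ‖z‖ = 1 := by simpa using hz
      have hz0 : z ≠ 0 := by
        rintro rfl
        simp at hz
      have hconj : starRingEnd ℂ z = z⁻¹ := by
        rw [Complex.inv_def, Complex.normSq_eq_norm_sq, hz1]
        simp
      have hlt : ‖w * z⁻¹‖ < 1 := by simpa [hz1] using hw
      have hs := Complex.hasSum_taylorSeries_neg_log hlt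
      have hs' := (Complex.hasSum_conj'.2 hs)
      have hlog : (Real.log ‖z - w‖ : ℂ) = (Complex.log (1 - w * z⁻¹)
          + starRingEnd ℂ (Complex.log (1 - w * z⁻¹))) / 2 := by
        rw [← Complex.re_eq_add_conj, Complex.log_re]
        congr 2
        rw [← one_mul ‖1 - w * z⁻¹‖, ← hz1, ← norm_mul]
        congr 1
        field_simp
      have hlog' : z ^ k * (Real.log ‖z - w‖ : ℂ) = -(z ^ k / 2) * (-Complex.log (1 - w * z⁻¹)
          + starRingEnd ℂ (-Complex.log (1 - w * z⁻¹))) := by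
        rw [hlog, map_neg]
        ring
      rw [hlog']
      have hsum := (hs.add hs').mul_left (-(z ^ k / 2))
      refine (congrArg (HasSum · _) (funext fun n => ?_)).mp hsum
      · symm
        simp only [smul_eq_mul, map_div₀, map_pow, map_mul, map_inv₀, hconj, inv_inv, map_natCast]
        rw [zpow_sub₀ hz0, zpow_add₀ hz0]
        simp only [zpow_natCast, mul_pow, inv_pow]
        rcases Nat.eq_zero_or_pos n with rfl | hn
        · simp
        · field_simp
          ring
  have h2 (n : ℕ) : Real.circleAverage (fun z : ℂ =>
      (-(w ^ n / (2 * n))) • z ^ ((k : ℤ) - n)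
        + (-((starRingEnd ℂ w) ^ n / (2 * n))) • z ^ ((k : ℤ) + n)) 0 1
      = if n = k then -w ^ k / (2 * k) else 0 := by
    have hc (m : ℤ) : CircleIntegrable (fun z : ℂ => z ^ m) 0 1 := by
      have := (circleIntegrable_sub_zpow_iff (c := 0) (w := 0) (R := 1) (n := m)).2 (by simp)
      simpa using this
    have hcs (c : ℂ) (m : ℤ) : CircleIntegrable (fun z : ℂ => c • z ^ m) 0 1 := (hc m).const_smul
    rw [Real.circleAverage_fun_add (hcs _ _) (hcs _ _),
      Real.circleAverage_fun_smul, Real.circleAverage_fun_smul,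
      circleAverage_zpow (m := (k : ℤ) + n) (by omega)]
    split_ifs with h
    · subst h
      simp [Real.circleAverage_const, neg_div]
    · rw [circleAverage_zpow (by omega)]
      simp
  simp only [h2] at h1
  exact h1.unique (hasSum_ite_eq k _)

lemma circleIntegrable_pow_mul_log_norm (k : ℕ) {f : ℂ → ℂ}
    (hf : CircleIntegrable (fun z => Real.log ‖f z‖) 0 1) :
    CircleIntegrable (fun z : ℂ => z ^ k * (Real.log ‖f z‖ : ℂ)) 0 1 := by
  have h : CircleIntegrable (fun z => (Real.log ‖f z‖ : ℂ)) 0 1 := by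
    unfold CircleIntegrable at *
    exact ⟨hf.1.ofReal, hf.2.ofReal⟩
  exact h.continuousOn_mul (f := fun z => (Real.log ‖f z‖ : ℂ)) (g := fun z => z ^ k) (by fun_prop)

lemma circleAverage_pow_mul_log_norm_sub_of_eq {k : ℕ} (hk : k ≠ 0) {w : ℂ} (hw : ‖w‖ = 1) :
    Real.circleAverage (fun z : ℂ => z ^ k * (Real.log ‖z - w‖ : ℂ)) 0 1 = -w ^ k / (2 * k) := by
  have hlim : Filter.Tendsto (fun r : ℝ =>
      Real.circleAverage (fun z : ℂ => z ^ k * (Real.log ‖z - r * w‖ : ℂ)) 0 1)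
      (nhdsWithin 1 (Set.Ioo 0 1))
      (nhds (Real.circleAverage (fun z : ℂ => z ^ k * (Real.log ‖z - w‖ : ℂ)) 0 1)) := by
    simp only [Real.circleAverage_def]
    refine Filter.Tendsto.const_smul ?_ _
    have hint (a : ℂ) := circleIntegrable_log_norm_sub_const (a := a) (c := 0) 1
    have hne : ∀ᵐ θ : ℝ, θ ∈ Set.uIoc 0 (2 * Real.pi) → circleMap 0 1 θ ≠ w := by
      have : {θ : ℝ | θ ∈ Set.uIoc 0 (2 * Real.pi) ∧ circleMap 0 1 θ = w}.Finite := by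
        apply Set.Finite.of_finite_image (f := circleMap 0 1) _ <|
          (injOn_circleMap_of_abs_sub_le one_ne_zero
            (by simp [le_of_eq, Real.pi_nonneg])).mono (fun _ h ↦ h.1)
        refine (Set.finite_singleton w).subset ?_
        rintro _ ⟨θ, ⟨_, h⟩, rfl⟩
        exact h
      have := this.measure_zero volume
      rw [ae_iff]
      convert this using 3
      simp
    refine intervalIntegral.tendsto_integral_filter_of_dominated_convergence
      (fun θ => Real.log 2 + |Real.log ‖circleMap 0 1 θ - w‖|) ?_ ?_ ?_ ?_
    · refine Filter.Eventually.of_forall fun r => ?_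
      exact (intervalIntegrable_iff.1
        (circleIntegrable_pow_mul_log_norm k (hint (r * w)))).aestronglyMeasurable
    · refine eventually_nhdsWithin_of_forall fun r hr => ?_
      filter_upwards [hne] with θ hθ hmem
      have hz1 : ‖circleMap 0 1 θ‖ = 1 := by simp
      generalize circleMap 0 1 θ = z at *
      have hzw : 0 < ‖z - w‖ := norm_pos_iff.2 (sub_ne_zero.2 (hθ hmem))
      have hrw : ‖w - r * w‖ = 1 - r := by
        rw [← one_sub_mul, norm_mul, hw, mul_one]
        rw [← Complex.ofReal_one, ← Complex.ofReal_sub, Complex.norm_real]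
        exact abs_of_pos (by linarith [hr.2])
      have hrn : ‖r * w‖ = r := by
        rw [norm_mul, hw, mul_one, Complex.norm_real]
        exact abs_of_pos hr.1
      have hr1 : 1 - r ≤ ‖z - r * w‖ := by
        have := norm_sub_norm_le z (r * w)
        rw [hz1, hrn] at this
        exact this
      have h1 : ‖z - w‖ / 2 ≤ ‖z - r * w‖ := by
        have := norm_sub_le_norm_sub_add_norm_sub z (r * w) w
        rw [norm_sub_rev (r * w : ℂ) w, hrw] at this
        linarith
      have h2 : ‖z - r * w‖ ≤ 2 := by
        refine (norm_sub_le _ _).trans ?_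
        rw [hz1, hrn]
        linarith [hr.2]
      have hl1 := Real.log_le_log (by positivity) h1
      rw [Real.log_div hzw.ne' two_ne_zero] at hl1
      have hl2 := Real.log_le_log (by linarith) h2
      rw [norm_mul, norm_pow, hz1, one_pow, one_mul, Complex.norm_real, Real.norm_eq_abs, abs_le]
      constructor
      · linarith [neg_abs_le (Real.log ‖z - w‖)]
      · linarith [abs_nonneg (Real.log ‖z - w‖)]
    · exact intervalIntegrable_const.add (hint w).abs
    · filter_upwards [hne] with θ hθ hmem
      have : ContinuousAt (fun r : ℝ => (circleMap 0 1 θ) ^ k *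
          (Real.log ‖circleMap 0 1 θ - r * w‖ : ℂ)) 1 := by
        refine continuousAt_const.mul (Complex.continuous_ofReal.continuousAt.comp
          (ContinuousAt.log ?_ ?_))
        · fun_prop
        · simpa [sub_eq_zero] using hθ hmem
      have := this.tendsto.mono_left (nhdsWithin_le_nhds (s := Set.Ioo 0 1))
      simpa using this
  have hlim' : Filter.Tendsto (fun r : ℝ => -(r * w : ℂ) ^ k / (2 * k))
      (nhdsWithin 1 (Set.Ioo 0 1)) (nhds (-w ^ k / (2 * k))) := by
    have : ContinuousAt (fun r : ℝ => -(r * w : ℂ) ^ k / (2 * k)) 1 := by fun_prop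
    simpa using this.tendsto.mono_left (nhdsWithin_le_nhds (s := Set.Ioo 0 1))
  have : (nhdsWithin (1 : ℝ) (Set.Ioo 0 1)).NeBot :=
    right_nhdsWithin_Ioo_neBot zero_lt_one
  refine tendsto_nhds_unique (hlim.congr' ?_) hlim'
  refine eventually_nhdsWithin_of_forall fun r hr => ?_
  refine circleAverage_pow_mul_log_norm_sub_of_lt hk ?_
  rw [norm_mul, hw, mul_one, Complex.norm_real, Real.norm_eq_abs, abs_of_pos hr.1]
  exact hr.2

/-- Inversion in the unit circle, folding the exterior of the closed unit disc into the disc. -/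
noncomputable def foldDisc (a : ℂ) : ℂ := if ‖a‖ ≤ 1 then a else (starRingEnd ℂ a)⁻¹

lemma circleAverage_pow_mul_log_norm_sub {k : ℕ} (hk : k ≠ 0) (a : ℂ) :
    Real.circleAverage (fun z : ℂ => z ^ k * (Real.log ‖z - a‖ : ℂ)) 0 1
      = -foldDisc a ^ k / (2 * k) := by
  unfold foldDisc
  split_ifs with h
  · rcases h.lt_or_eq with h | h
    · exact circleAverage_pow_mul_log_norm_sub_of_lt hk h
    · exact circleAverage_pow_mul_log_norm_sub_of_eq hk h
  · have ha : 0 < ‖a‖ := by linarith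
    have ha0 : starRingEnd ℂ a ≠ 0 := by simpa using ha
    have hlt : ‖(starRingEnd ℂ a)⁻¹‖ < 1 := by
      rw [norm_inv, RCLike.norm_conj]
      exact inv_lt_one_of_one_lt₀ (not_le.1 h)
    have hcongr : Real.circleAverage (fun z : ℂ => z ^ k * (Real.log ‖z - a‖ : ℂ)) 0 1
        = Real.circleAverage (fun z : ℂ => (Real.log ‖a‖ : ℂ) • z ^ (k : ℤ)
          + z ^ k * (Real.log ‖z - (starRingEnd ℂ a)⁻¹‖ : ℂ)) 0 1 := by
      refine Real.circleAverage_congr_sphere fun z hz => ?_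
      have hz1 : ‖z‖ = 1 := by simpa using hz
      have hzz : z * starRingEnd ℂ z = 1 := by
        rw [Complex.mul_conj, Complex.normSq_eq_norm_sq, hz1]
        simp
      have hne : z - (starRingEnd ℂ a)⁻¹ ≠ 0 := by
        rw [sub_ne_zero]
        rintro rfl
        exact hlt.ne hz1
      have hnorm : ‖z - a‖ = ‖a‖ * ‖z - (starRingEnd ℂ a)⁻¹‖ := by
        rw [← RCLike.norm_conj a, ← norm_mul, mul_sub, mul_inv_cancel₀ ha0,
          ← RCLike.norm_conj (z - a), map_sub]
        have : starRingEnd ℂ a * z - 1 = - (z * (starRingEnd ℂ z - starRingEnd ℂ a)) := by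
          rw [mul_sub, hzz]
          ring
        rw [this, norm_neg, norm_mul, hz1, one_mul]
      simp only [hnorm, smul_eq_mul, zpow_natCast]
      rw [Real.log_mul ha.ne' (norm_ne_zero_iff.2 hne)]
      push_cast
      ring
    rw [hcongr, Real.circleAverage_fun_add _
      (circleIntegrable_pow_mul_log_norm k (circleIntegrable_log_norm_sub_const 1)),
      Real.circleAverage_fun_smul, circleAverage_zpow (by omega), smul_zero, zero_add,
      circleAverage_pow_mul_log_norm_sub_of_lt hk hlt]
    simp only [zpow_natCast]
    exact ContinuousOn.circleIntegrable zero_le_one (by fun_prop)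

lemma circleAverage_pow_mul_log_norm_eval_mul (k : ℕ) {p q : Polynomial ℂ} (hp : p ≠ 0)
    (hq : q ≠ 0) :
    Real.circleAverage (fun z : ℂ => z ^ k * (Real.log ‖(p * q).eval z‖ : ℂ)) 0 1
      = Real.circleAverage (fun z : ℂ => z ^ k * (Real.log ‖p.eval z‖ : ℂ)) 0 1
        + Real.circleAverage (fun z : ℂ => z ^ k * (Real.log ‖q.eval z‖ : ℂ)) 0 1 := by
  have hint (p : Polynomial ℂ) := circleIntegrable_pow_mul_log_norm k
    (f := fun z => p.eval z) p.intervalIntegrable_mahlerMeasure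
  rw [← Real.circleAverage_fun_add (hint p) (hint q)]
  simp only [Real.circleAverage_def]
  congr 1
  apply intervalIntegral.integral_congr_ae
  rw [ae_iff]
  apply Set.Finite.measure_zero _ volume
  simp only [Classical.not_imp]
  apply Set.Finite.of_finite_image (f := circleMap 0 1) _ <|
    (injOn_circleMap_of_abs_sub_le one_ne_zero
      (by simp [le_of_eq, Real.pi_nonneg])).mono (fun _ h ↦ h.1)
  apply (p * q).roots.finite_toSet.subset
  rintro _ ⟨θ, ⟨_, h⟩, rfl⟩
  contrapose h
  have hz : p.eval (circleMap 0 1 θ) ≠ 0 ∧ q.eval (circleMap 0 1 θ) ≠ 0 := by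
    simpa [hp, hq] using h
  rw [Polynomial.eval_mul, norm_mul,
    Real.log_mul (norm_ne_zero_iff.2 hz.1) (norm_ne_zero_iff.2 hz.2)]
  push_cast
  ring

lemma circleAverage_pow_mul_log_norm_eval {k : ℕ} (hk : k ≠ 0) {p : Polynomial ℂ} (hp : p ≠ 0) :
    Real.circleAverage (fun z : ℂ => z ^ k * (Real.log ‖p.eval z‖ : ℂ)) 0 1
      = -(p.roots.map fun a => foldDisc a ^ k).sum / (2 * k) := by
  have hconst (c : ℂ) :
      Real.circleAverage (fun z : ℂ => z ^ k * (Real.log ‖(Polynomial.C c).eval z‖ : ℂ)) 0 1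
        = 0 := by
    have : (fun z : ℂ => z ^ k * (Real.log ‖(Polynomial.C c).eval z‖ : ℂ))
        = fun z => (Real.log ‖c‖ : ℂ) • z ^ (k : ℤ) := by
      ext z
      simp [mul_comm]
    rw [this, Real.circleAverage_fun_smul, circleAverage_zpow (by omega), smul_zero]
  have hprod (s : Multiset ℂ) : Real.circleAverage (fun z : ℂ => z ^ k *
      (Real.log ‖((s.map fun a => Polynomial.X - Polynomial.C a).prod).eval z‖ : ℂ)) 0 1
      = -(s.map fun a => foldDisc a ^ k).sum / (2 * k) := by
    induction s using Multiset.induction_on with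
    | empty => simpa using hconst 1
    | cons a s ih =>
      rw [Multiset.map_cons, Multiset.prod_cons, circleAverage_pow_mul_log_norm_eval_mul k
        (Polynomial.X_sub_C_ne_zero a) (Multiset.prod_ne_zero (by
          simp [Polynomial.X_sub_C_ne_zero])), ih, Multiset.map_cons, Multiset.sum_cons]
      have := circleAverage_pow_mul_log_norm_sub hk a
      simp only [Polynomial.eval_sub, Polynomial.eval_X, Polynomial.eval_C]
      rw [this]
      ring
  have hsplit := (IsAlgClosed.splits p).eq_prod_roots
  have hmul := circleAverage_pow_mul_log_norm_eval_mul k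
    (Polynomial.C_ne_zero.2 (Polynomial.leadingCoeff_ne_zero.2 hp))
    (p := Polynomial.C p.leadingCoeff)
    (q := (p.roots.map fun a => Polynomial.X - Polynomial.C a).prod)
    (Multiset.prod_ne_zero (by simp [Polynomial.X_sub_C_ne_zero]))
  rwa [← hsplit, hconst, zero_add, hprod] at hmul

lemma norm_eval_le_sum_norm_coeff (p : Polynomial ℂ) {z : ℂ} (hz : ‖z‖ = 1) :
    ‖p.eval z‖ ≤ p.sum fun _ a => ‖a‖ := by
  rw [Polynomial.eval_eq_sum, Polynomial.sum, Polynomial.sum]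
  refine (norm_sum_le _ _).trans (Finset.sum_le_sum fun i _ => ?_)
  simp [hz]

lemma norm_sum_foldDisc_pow_le {p : Polynomial ℂ} (hp : p ≠ 0) {B : ℝ} (hB : 0 ≤ B)
    (hpB : (p.sum fun _ a => ‖a‖) ≤ Real.exp B) {k : ℕ} (hk : k ≠ 0) :
    ‖(p.roots.map fun a => foldDisc a ^ k).sum‖
      ≤ 2 * k * (2 * B - Real.log ‖p.leadingCoeff‖) := by
  have hk0 : (0 : ℝ) < 2 * k := by positivity
  have hint : CircleIntegrable (fun z => Real.log ‖p.eval z‖) 0 1 :=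
    p.intervalIntegrable_mahlerMeasure
  have h1 : ‖(p.roots.map fun a => foldDisc a ^ k).sum‖ = 2 * k *
      ‖Real.circleAverage (fun z : ℂ => z ^ k * (Real.log ‖p.eval z‖ : ℂ)) 0 1‖ := by
    rw [circleAverage_pow_mul_log_norm_eval hk hp, norm_div, norm_neg, norm_mul,
      Complex.norm_natCast, Complex.norm_ofNat]
    field_simp
  have h2 : ‖Real.circleAverage (fun z : ℂ => z ^ k * (Real.log ‖p.eval z‖ : ℂ)) 0 1‖
      ≤ Real.circleAverage (fun z => |Real.log ‖p.eval z‖|) 0 1 := by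
    rw [Real.circleAverage_def, Real.circleAverage_def, norm_smul, Real.norm_eq_abs,
      abs_of_pos (by positivity), smul_eq_mul]
    gcongr
    refine (intervalIntegral.norm_integral_le_integral_norm (by positivity)).trans_eq ?_
    refine intervalIntegral.integral_congr fun θ _ => ?_
    simp
  have h3 : Real.circleAverage (fun z => |Real.log ‖p.eval z‖|) 0 1
      ≤ Real.circleAverage (fun z => 2 * B - Real.log ‖p.eval z‖) 0 1 := by
    refine Real.circleAverage_mono hint.abs ((circleIntegrable_const _ _ _).sub hint) ?_
    intro z hz
    have hz1 : ‖z‖ = 1 := by simpa using hz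
    have hle : Real.log ‖p.eval z‖ ≤ B := by
      rcases eq_or_ne (p.eval z) 0 with h | h
      · simpa [h] using hB
      · rw [Real.log_le_iff_le_exp (norm_pos_iff.2 h)]
        exact (norm_eval_le_sum_norm_coeff p hz1).trans hpB
    rw [abs_le]
    constructor <;> linarith
  rw [Real.circleAverage_fun_sub (circleIntegrable_const _ _ _) hint,
    Real.circleAverage_const] at h3
  have h4 : Real.log ‖p.leadingCoeff‖ ≤ Real.circleAverage (fun z => Real.log ‖p.eval z‖) 0 1 := by
    rw [← Polynomial.logMahlerMeasure_def,
      p.logMahlerMeasure_eq_log_leadingCoeff_add_sum_log_roots, le_add_iff_nonneg_right]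
    refine Multiset.sum_nonneg ?_
    simp only [Multiset.mem_map]
    rintro _ ⟨a, _, rfl⟩
    exact Real.posLog_nonneg
  rw [h1]
  gcongr
  linarith

lemma sum_abs_log_norm_roots_le {p : Polynomial ℂ} (hp0 : p.coeff 0 ≠ 0) {B : ℝ}
    (hpB : (p.sum fun _ a => ‖a‖) ≤ Real.exp B) :
    (p.roots.map fun a => |Real.log ‖a‖|).sum
      ≤ 2 * B - Real.log ‖p.leadingCoeff‖ - Real.log ‖p.coeff 0‖ := by
  have hp : p ≠ 0 := by
    rintro rfl
    simp at hp0
  have hlc : p.leadingCoeff ≠ 0 := Polynomial.leadingCoeff_ne_zero.2 hp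
  have hroots : ∀ a ∈ p.roots, a ≠ 0 := by
    rintro _ ha rfl
    rw [Polynomial.mem_roots hp, Polynomial.IsRoot, ← Polynomial.coeff_zero_eq_eval_zero] at ha
    exact hp0 ha
  have hM : p.logMahlerMeasure ≤ B := by
    rw [p.logMahlerMeasure_eq_log_MahlerMeasure,
      Real.log_le_iff_le_exp (p.mahlerMeasure_pos_of_ne_zero hp)]
    exact (p.mahlerMeasure_le_sum_norm_coeff).trans hpB
  rw [p.logMahlerMeasure_eq_log_leadingCoeff_add_sum_log_roots] at hM
  have hlog : Real.log ‖p.coeff 0‖ = Real.log ‖p.leadingCoeff‖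
      + (p.roots.map fun a => Real.log ‖a‖).sum := by
    rw [(IsAlgClosed.splits p).coeff_zero_eq_leadingCoeff_mul_prod_roots, norm_mul, norm_mul,
      norm_pow, norm_neg, norm_one, one_pow, one_mul]
    have hlogprod (s : Multiset ℂ) (hs : ∀ a ∈ s, a ≠ 0) :
        Real.log ‖s.prod‖ = (s.map fun a => Real.log ‖a‖).sum := by
      induction s using Multiset.induction_on with
      | empty => simp
      | cons a s ih =>
        have hs' : ∀ b ∈ s, b ≠ 0 := fun b hb => hs b (Multiset.mem_cons_of_mem hb)
        rw [Multiset.prod_cons, norm_mul, Real.log_mul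
          (norm_ne_zero_iff.2 (hs a (Multiset.mem_cons_self a s)))
          (norm_ne_zero_iff.2 (Multiset.prod_ne_zero fun h => hs' 0 h rfl)), ih hs',
          Multiset.map_cons, Multiset.sum_cons]
    rw [Real.log_mul (norm_ne_zero_iff.2 hlc)
      (norm_ne_zero_iff.2 (Multiset.prod_ne_zero fun h => hroots 0 h rfl)), hlogprod _ hroots]
  have habs : (p.roots.map fun a => |Real.log ‖a‖|).sum
      = 2 * (p.roots.map fun a => Real.posLog ‖a‖).sum
        - (p.roots.map fun a => Real.log ‖a‖).sum := by
    rw [← Multiset.sum_map_mul_left, ← Multiset.sum_map_sub]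
    congr 2
    ext a
    rw [← Real.half_mul_log_add_log_abs]
    ring
  rw [habs]
  linarith

lemma tendsto_of_tendsto_on_span {E : Type*} [SeminormedAddCommGroup E] [NormedSpace ℂ E]
    {A : ℕ → E →ₗ[ℂ] ℂ} {I : E →ₗ[ℂ] ℂ} {S : Set E}
    (hS : (Submodule.span ℂ S).topologicalClosure = ⊤)
    (hA : ∀ᶠ N in Filter.atTop, ∀ x, ‖A N x‖ ≤ ‖x‖) (hI : ∀ x, ‖I x‖ ≤ ‖x‖)
    (hlim : ∀ x ∈ S, Filter.Tendsto (fun N => A N x) Filter.atTop (nhds (I x))) (x : E) :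
    Filter.Tendsto (fun N => A N x) Filter.atTop (nhds (I x)) := by
  have hspan : ∀ y ∈ Submodule.span ℂ S,
      Filter.Tendsto (fun N => A N y) Filter.atTop (nhds (I y)) := by
    intro y hy
    induction hy using Submodule.span_induction with
    | mem y hy => exact hlim y hy
    | zero => simp
    | add y z _ _ ihy ihz => simpa using ihy.add ihz
    | smul c y _ ihy => simpa using ihy.const_mul c
  rw [Metric.tendsto_nhds]
  intro ε hε
  have hx : x ∈ closure (Submodule.span ℂ S : Set E) := by
    rw [← Submodule.topologicalClosure_coe, hS]
    trivial
  obtain ⟨y, hy, hxy⟩ := Metric.mem_closure_iff.1 hx (ε / 3) (by positivity)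
  rw [dist_eq_norm] at hxy
  filter_upwards [hA, Metric.tendsto_nhds.1 (hspan y hy) (ε / 3) (by positivity)] with N hN hyN
  rw [dist_eq_norm] at hyN ⊢
  have h1 := hN (x - y)
  have h2 := hI (x - y)
  rw [map_sub] at h1 h2
  calc ‖A N x - I x‖ = ‖(A N x - A N y) + (A N y - I y) - (I x - I y)‖ := by
        congr 1
        ring
    _ ≤ ‖A N x - A N y‖ + ‖A N y - I y‖ + ‖I x - I y‖ :=
        (norm_sub_le _ _).trans (add_le_add_left (norm_add_le _ _) _)
    _ < ε := by linarith

lemma foldDisc_eq {a : ℂ} (ha : a ≠ 0) :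
    foldDisc a = (Real.exp (-|Real.log ‖a‖|) : ℂ) * Complex.exp (a.arg * Complex.I) := by
  have hpos : 0 < ‖a‖ := norm_pos_iff.2 ha
  have hpol := Complex.norm_mul_exp_arg_mul_I a
  unfold foldDisc
  split_ifs with h
  · rw [abs_of_nonpos (Real.log_nonpos hpos.le h), neg_neg, Real.exp_log hpos, hpol]
  · rw [abs_of_nonneg (Real.log_nonneg (not_le.1 h).le), Real.exp_neg, Real.exp_log hpos]
    conv_lhs => rw [← hpol]
    rw [map_mul, Complex.conj_ofReal, ← Complex.exp_conj, mul_inv, ← Complex.exp_neg]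
    simp

lemma norm_foldDisc_pow_sub_le {a : ℂ} (ha : a ≠ 0) (k : ℕ) :
    ‖foldDisc a ^ k - Complex.exp (a.arg * Complex.I) ^ k‖ ≤ k * |Real.log ‖a‖| := by
  have hu : ‖Complex.exp (a.arg * Complex.I)‖ = 1 := Complex.norm_exp_ofReal_mul_I _
  rw [foldDisc_eq ha, mul_pow, ← sub_one_mul, norm_mul, norm_pow, hu, one_pow, mul_one,
    ← Complex.ofReal_pow, ← Complex.ofReal_one, ← Complex.ofReal_sub, Complex.norm_real,
    ← Real.exp_nat_mul, Real.norm_eq_abs, abs_sub_comm, abs_of_nonneg]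
  · linarith [Real.add_one_le_exp (k * -|Real.log ‖a‖|)]
  · rw [sub_nonneg, Real.exp_le_one_iff]
    have : 0 ≤ (k : ℝ) * |Real.log ‖a‖| := by positivity
    linarith

lemma Multiset.norm_sum_map_sub_sum_map_le {E : Type*} [SeminormedAddCommGroup E] {s : Multiset ℂ}
    {f g : ℂ → E} {h : ℂ → ℝ} (hfg : ∀ a ∈ s, ‖f a - g a‖ ≤ h a) :
    ‖(s.map f).sum - (s.map g).sum‖ ≤ (s.map h).sum := by
  induction s using Multiset.induction_on with
  | empty => simp
  | cons a s ih =>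
    simp only [Multiset.map_cons, Multiset.sum_cons]
    rw [add_sub_add_comm]
    exact (norm_add_le _ _).trans (add_le_add (hfg a (Multiset.mem_cons_self a s))
      (ih fun b hb => hfg b (Multiset.mem_cons_of_mem hb)))

instance fact_zero_lt_two_pi : Fact (0 < 2 * Real.pi) := ⟨Real.two_pi_pos⟩

/-- The average over `s`, normalized by `N`, of a function of the argument. -/
noncomputable def argAverage (N : ℕ) (s : Multiset ℂ) : C(AddCircle (2 * Real.pi), ℂ) →ₗ[ℂ] ℂ where
  toFun ψ := (N : ℂ)⁻¹ * (s.map fun a => ψ (a.arg : AddCircle (2 * Real.pi))).sum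
  map_add' ψ χ := by simp [Multiset.sum_map_add, mul_add]
  map_smul' c ψ := by
    simp [Multiset.sum_map_mul_left]
    ring

noncomputable def circleMean : C(AddCircle (2 * Real.pi), ℂ) →ₗ[ℂ] ℂ where
  toFun ψ := (2 * Real.pi : ℂ)⁻¹ * ∫ θ in (0 : ℝ)..(2 * Real.pi), ψ (θ : AddCircle (2 * Real.pi))
  map_add' ψ χ := by
    have h (ψ : C(AddCircle (2 * Real.pi), ℂ)) : Continuous fun θ : ℝ => ψ θ :=
      ψ.continuous.comp (AddCircle.continuous_mk' _)
    simp only [ContinuousMap.add_apply]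
    rw [intervalIntegral.integral_add ((h ψ).intervalIntegrable _ _)
      ((h χ).intervalIntegrable _ _), mul_add]
  map_smul' c ψ := by
    simp
    ring

lemma norm_circleMean_le (ψ : C(AddCircle (2 * Real.pi), ℂ)) : ‖circleMean ψ‖ ≤ ‖ψ‖ := by
  have h := intervalIntegral.norm_integral_le_of_norm_le_const (a := (0 : ℝ)) (b := 2 * Real.pi)
    (f := fun θ : ℝ => ψ (θ : AddCircle (2 * Real.pi))) (C := ‖ψ‖)
    fun θ _ => ψ.norm_coe_le_norm _
  have hpi : (0 : ℝ) < 2 * Real.pi := Real.two_pi_pos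
  have h2 : ‖(2 * Real.pi : ℂ)⁻¹‖ = (2 * Real.pi)⁻¹ := by
    rw [norm_inv, norm_mul, Complex.norm_real, Complex.norm_ofNat,
      Real.norm_of_nonneg Real.pi_nonneg]
  rw [sub_zero, abs_of_pos hpi] at h
  change ‖(2 * Real.pi : ℂ)⁻¹ * _‖ ≤ _
  rw [norm_mul, h2, inv_mul_le_iff₀ hpi]
  linarith

lemma norm_argAverage_le {N : ℕ} {s : Multiset ℂ} (hs : s.card = N)
    (ψ : C(AddCircle (2 * Real.pi), ℂ)) : ‖argAverage N s ψ‖ ≤ ‖ψ‖ := by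
  have h : ‖(s.map fun a => ψ (a.arg : AddCircle (2 * Real.pi))).sum‖ ≤ N * ‖ψ‖ := by
    have := Multiset.norm_sum_map_sub_sum_map_le (s := s)
      (f := fun a => ψ (a.arg : AddCircle (2 * Real.pi))) (g := fun _ => 0) (h := fun _ => ‖ψ‖)
      fun a _ => by simpa using ψ.norm_coe_le_norm _
    simpa [hs] using this
  change ‖(N : ℂ)⁻¹ * _‖ ≤ _
  rw [norm_mul, norm_inv, Complex.norm_natCast]
  rcases Nat.eq_zero_or_pos N with rfl | hN
  · simp
  · rwa [inv_mul_le_iff₀ (by exact_mod_cast hN)]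

lemma circleMean_fourier {n : ℤ} (hn : n ≠ 0) : circleMean (fourier n) = 0 := by
  have h := circleAverage_zpow hn
  rw [Real.circleAverage_def] at h
  have hpi : (2 * Real.pi)⁻¹ ≠ 0 := by positivity
  rw [smul_eq_zero_iff_right hpi] at h
  change (2 * Real.pi : ℂ)⁻¹ * _ = _
  rw [mul_eq_zero]
  right
  rw [← h]
  refine intervalIntegral.integral_congr fun θ _ => ?_
  simp only [fourier_coe_apply, circleMap, ← Complex.exp_int_mul, Complex.ofReal_one, one_mul,
    zero_add]
  congr 1
  push_cast
  field_simp

lemma circleMean_one : circleMean 1 = 1 := by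
  change (2 * Real.pi : ℂ)⁻¹ * _ = _
  have := Real.pi_ne_zero
  simp
  field_simp

lemma fourier_arg (n : ℤ) (a : ℂ) :
    fourier n (a.arg : AddCircle (2 * Real.pi)) = Complex.exp (a.arg * Complex.I) ^ n := by
  rw [fourier_coe_apply, ← Complex.exp_int_mul]
  congr 1
  push_cast
  field_simp

lemma tendsto_argAverage {s : ℕ → Multiset ℂ}
    (hcard : ∀ᶠ N in Filter.atTop, (s N).card = N) (hzero : ∀ᶠ N in Filter.atTop, 0 ∉ s N)
    (hlog : Filter.Tendsto (fun N : ℕ => (N : ℝ)⁻¹ * ((s N).map fun a => |Real.log ‖a‖|).sum)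
      Filter.atTop (nhds 0))
    (hfold : ∀ k : ℕ, k ≠ 0 → Filter.Tendsto
      (fun N : ℕ => (N : ℝ)⁻¹ * ‖((s N).map fun a => foldDisc a ^ k).sum‖) Filter.atTop (nhds 0))
    (ψ : C(AddCircle (2 * Real.pi), ℂ)) :
    Filter.Tendsto (fun N => argAverage N (s N) ψ) Filter.atTop (nhds (circleMean ψ)) := by
  have hpow (k : ℕ) (hk : k ≠ 0) : Filter.Tendsto
      (fun N => argAverage N (s N) (fourier k)) Filter.atTop (nhds 0) := by
    have hbound := (hfold k hk).add (hlog.const_mul (k : ℝ))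
    rw [mul_zero, add_zero] at hbound
    refine squeeze_zero_norm' ?_ hbound
    filter_upwards [hzero] with N hN
    change ‖(N : ℂ)⁻¹ * _‖ ≤ _
    rw [norm_mul, norm_inv, Complex.norm_natCast, mul_left_comm, ← mul_add]
    gcongr
    have := Multiset.norm_sum_map_sub_sum_map_le (s := s N)
      (f := fun a => Complex.exp (a.arg * Complex.I) ^ k) (g := fun a => foldDisc a ^ k)
      (h := fun a => k * |Real.log ‖a‖|) fun a ha => by
        rw [norm_sub_rev]
        exact norm_foldDisc_pow_sub_le (fun h => hN (h ▸ ha)) k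
    rw [Multiset.sum_map_mul_left] at this
    simp only [fourier_arg, zpow_natCast]
    have htri := norm_le_norm_sub_add (((s N).map fun a => Complex.exp (a.arg * Complex.I) ^ k).sum)
      ((s N).map fun a => foldDisc a ^ k).sum
    linarith
  refine tendsto_of_tendsto_on_span span_fourier_closure_eq_top ?_ norm_circleMean_le ?_ ψ
  · filter_upwards [hcard] with N hN using norm_argAverage_le hN
  · rintro _ ⟨n, rfl⟩
    rcases eq_or_ne n 0 with rfl | hn
    · have h1 : (fourier 0 : C(AddCircle (2 * Real.pi), ℂ)) = 1 := by
        ext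
        simp
      rw [h1, circleMean_one]
      refine tendsto_const_nhds.congr' ?_
      filter_upwards [hcard, Filter.eventually_ne_atTop 0] with N hN hN0
      change _ = (N : ℂ)⁻¹ * _
      have : (N : ℂ) ≠ 0 := by exact_mod_cast hN0
      simp [hN, this]
    · rw [circleMean_fourier hn]
      obtain ⟨k, rfl | rfl⟩ := n.eq_nat_or_neg
      · exact hpow k (by simpa using hn)
      · have := (hpow k (by simpa using hn)).star
        rw [star_zero] at this
        refine this.congr fun N => ?_
        change star ((N : ℂ)⁻¹ * _) = (N : ℂ)⁻¹ * _
        simp only [fourier_neg]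
        rw [star_mul']
        congr 1
        · simp
        · exact (map_multiset_sum (starRingEnd ℂ) _).trans (by simp [Multiset.map_map])

lemma tendsto_sum_map_of_foldDisc {s : ℕ → Multiset ℂ}
    (hcard : ∀ᶠ N in Filter.atTop, (s N).card = N) (hzero : ∀ᶠ N in Filter.atTop, 0 ∉ s N)
    (hlog : Filter.Tendsto (fun N : ℕ => (N : ℝ)⁻¹ * ((s N).map fun a => |Real.log ‖a‖|).sum)
      Filter.atTop (nhds 0))
    (hfold : ∀ k : ℕ, k ≠ 0 → Filter.Tendsto
      (fun N : ℕ => (N : ℝ)⁻¹ * ‖((s N).map fun a => foldDisc a ^ k).sum‖) Filter.atTop (nhds 0))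
    {φ : ℂ → ℝ} (hφ : Continuous φ) (hsupp : HasCompactSupport φ) :
    Filter.Tendsto (fun N : ℕ => (N : ℝ)⁻¹ * ((s N).map φ).sum) Filter.atTop
      (nhds ((2 * Real.pi)⁻¹ *
        ∫ θ in (0 : ℝ)..(2 * Real.pi), φ (Complex.exp ((θ : ℂ) * Complex.I)))) := by
  have hcircle (θ : ℝ) : (AddCircle.toCircle (θ : AddCircle (2 * Real.pi)) : ℂ)
      = Complex.exp (θ * Complex.I) := by
    rw [AddCircle.toCircle_apply_mk, Circle.coe_exp]
    congr 2
    have := Real.pi_ne_zero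
    push_cast
    field_simp
  let ψ : C(AddCircle (2 * Real.pi), ℂ) :=
    ⟨fun x => (φ (x.toCircle : ℂ) : ℂ), Complex.continuous_ofReal.comp (hφ.comp
      (continuous_subtype_val.comp AddCircle.continuous_toCircle))⟩
  have hψ (θ : ℝ) : ψ (θ : AddCircle (2 * Real.pi)) = (φ (Complex.exp (θ * Complex.I)) : ℂ) := by
    rw [← hcircle θ]
    rfl
  have hmean : circleMean ψ = (((2 * Real.pi)⁻¹ *
        ∫ θ in (0 : ℝ)..(2 * Real.pi), φ (Complex.exp ((θ : ℂ) * Complex.I)) : ℝ) : ℂ) := by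
    change (2 * Real.pi : ℂ)⁻¹ * _ = _
    simp only [hψ]
    rw [intervalIntegral.integral_ofReal]
    push_cast
    rfl
  have havg (N : ℕ) : argAverage N (s N) ψ = (((N : ℝ)⁻¹ * ((s N).map fun a =>
      φ (Complex.exp (a.arg * Complex.I))).sum : ℝ) : ℂ) := by
    change (N : ℂ)⁻¹ * _ = _
    simp only [hψ]
    push_cast
    congr 1
    exact ((map_multiset_sum Complex.ofRealHom _).trans (by simp [Multiset.map_map])).symm
  have hlim := tendsto_argAverage hcard hzero hlog hfold ψ
  simp only [havg, hmean] at hlim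
  have hlim' := (Complex.continuous_re.tendsto _).comp hlim
  simp only [Function.comp_def, Complex.ofReal_re] at hlim'
  obtain ⟨M, hM⟩ := hsupp.exists_bound_of_continuous hφ
  have hM0 : 0 ≤ M := (norm_nonneg _).trans (hM 0)
  have huc := hsupp.uniformContinuous_of_continuous hφ
  have hdiff : Filter.Tendsto (fun N : ℕ => (N : ℝ)⁻¹ * ((s N).map φ).sum
      - (N : ℝ)⁻¹ * ((s N).map fun a => φ (Complex.exp (a.arg * Complex.I))).sum)
      Filter.atTop (nhds 0) := by
    rw [Metric.tendsto_nhds]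
    intro ε hε
    obtain ⟨δ, hδ, hδφ⟩ := Metric.uniformContinuous_iff.1 huc (ε / 2) (by positivity)
    obtain ⟨η, hη, hηδ⟩ :=
      Metric.continuousAt_iff.1 (Real.continuous_exp.continuousAt (x := 0)) δ hδ
    have hpt : ∀ a : ℂ, a ≠ 0 → ‖φ a - φ (Complex.exp (a.arg * Complex.I))‖
        ≤ ε / 2 + 2 * M / η * |Real.log ‖a‖| := by
      intro a ha
      rcases lt_or_ge |Real.log ‖a‖| η with h | h
      · have h1 : dist a (Complex.exp (a.arg * Complex.I)) < δ := by
          have := hηδ (x := Real.log ‖a‖) (by simpa [Real.dist_eq] using h)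
          rw [Real.exp_log (norm_pos_iff.2 ha), Real.exp_zero, Real.dist_eq] at this
          have h2 : a - Complex.exp (a.arg * Complex.I)
              = ((‖a‖ - 1 : ℝ) : ℂ) * Complex.exp (a.arg * Complex.I) := by
            conv_lhs => rw [← Complex.norm_mul_exp_arg_mul_I a]
            rw [Complex.norm_mul_exp_arg_mul_I a]
            push_cast
            rw [sub_one_mul, Complex.norm_mul_exp_arg_mul_I a]
          rwa [dist_eq_norm, h2, norm_mul, Complex.norm_exp_ofReal_mul_I, mul_one,
            Complex.norm_real]
        have h3 := hδφ h1
        rw [dist_eq_norm] at h3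
        have : 0 ≤ 2 * M / η * |Real.log ‖a‖| := by positivity
        linarith
      · have h1 : 2 * M ≤ 2 * M / η * |Real.log ‖a‖| := by
          rw [div_mul_eq_mul_div, le_div_iff₀ hη]
          gcongr
        have h2 := norm_sub_le (φ a) (φ (Complex.exp (a.arg * Complex.I)))
        linarith [hM a, hM (Complex.exp (a.arg * Complex.I))]
    have hsmall := hlog.const_mul (2 * M / η)
    rw [mul_zero] at hsmall
    filter_upwards [hcard, hzero, Filter.eventually_gt_atTop 0,
      Metric.tendsto_nhds.1 hsmall (ε / 2) (by positivity)] with N hN h0 hN0 hNs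
    have hNpos : (0 : ℝ) < N := by exact_mod_cast hN0
    have hsum := Multiset.norm_sum_map_sub_sum_map_le (s := s N) (f := φ)
      (g := fun a => φ (Complex.exp (a.arg * Complex.I))) fun a ha => hpt a (fun h => h0 (h ▸ ha))
    rw [Multiset.sum_map_add, Multiset.sum_map_mul_left, Multiset.map_const',
      Multiset.sum_replicate, hN, nsmul_eq_mul] at hsum
    rw [Real.dist_eq, sub_zero] at hNs
    have hNs' := (le_abs_self _).trans_lt hNs
    rw [dist_zero_right, ← mul_sub, norm_mul, norm_inv, Real.norm_of_nonneg hNpos.le,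
      inv_mul_lt_iff₀ hNpos]
    refine hsum.trans_lt ?_
    have h5 : 2 * M / η * ((s N).map fun a => |Real.log ‖a‖|).sum < N * (ε / 2) := by
      rw [mul_left_comm, inv_mul_lt_iff₀ hNpos] at hNs'
      exact hNs'
    linarith
  simpa using hdiff.add hlim'

lemma lintegral_exp_neg_mul_sq_norm (n : ℕ) {b : ℝ} (hb : 0 < b) :
    ∫⁻ c : EuclideanSpace ℂ (Fin n),
      ENNReal.ofReal ((Real.pi ^ n)⁻¹ * Real.exp (-b * ‖c‖ ^ 2)) = ENNReal.ofReal (b⁻¹ ^ n) := by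
  have hint : ∫ c : EuclideanSpace ℂ (Fin n), Real.exp (-b * ‖c‖ ^ 2) = (Real.pi / b) ^ n := by
    rw [GaussianFourier.integral_rexp_neg_mul_sq_norm hb, ← Module.finrank_mul_finrank ℝ ℂ]
    simp
  have hpos : 0 < (Real.pi / b) ^ n := by positivity
  have hi : Integrable fun c : EuclideanSpace ℂ (Fin n) => Real.exp (-b * ‖c‖ ^ 2) :=
    not_imp_comm.1 integral_undef (hint ▸ hpos.ne')
  rw [← ofReal_integral_eq_lintegral_ofReal (hi.const_mul _)
    (Filter.Eventually.of_forall fun c => by positivity), integral_const_mul, hint]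
  rw [div_eq_mul_inv, mul_pow, inv_mul_cancel_left₀ (by positivity)]

/-- A Gaussian vector in `ℂⁿ` has norm larger than `2n` with probability at most `exp (-n)`. -/
lemma gammaC_lt_norm_le (n : ℕ) :
    gammaC n {c | 2 * (n : ℝ) < ‖c‖} ≤ ENNReal.ofReal (Real.exp (-n)) := by
  have hA : MeasurableSet {c : EuclideanSpace ℂ (Fin n) | 2 * (n : ℝ) < ‖c‖} :=
    (isOpen_lt continuous_const continuous_norm).measurableSet
  rw [gammaC, withDensity_apply _ hA]
  calc _ ≤ ∫⁻ c in {c : EuclideanSpace ℂ (Fin n) | 2 * (n : ℝ) < ‖c‖},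
        ENNReal.ofReal (Real.exp (-(2 * n ^ 2))) *
          ENNReal.ofReal ((Real.pi ^ n)⁻¹ * Real.exp (-2⁻¹ * ‖c‖ ^ 2)) := by
        refine setLIntegral_mono' hA fun c hc => ?_
        rw [← ENNReal.ofReal_mul (by positivity), mul_left_comm, ← Real.exp_add]
        have hc : 2 * (n : ℝ) < ‖c‖ := hc
        gcongr
        nlinarith [(Nat.cast_nonneg n : (0 : ℝ) ≤ n)]
    _ ≤ ∫⁻ c : EuclideanSpace ℂ (Fin n), ENNReal.ofReal (Real.exp (-(2 * n ^ 2))) *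
          ENNReal.ofReal ((Real.pi ^ n)⁻¹ * Real.exp (-2⁻¹ * ‖c‖ ^ 2)) :=
        setLIntegral_le_lintegral _ _
    _ = ENNReal.ofReal (Real.exp (-(2 * n ^ 2)) * 2 ^ n) := by
        rw [lintegral_const_mul' _ _ ENNReal.ofReal_ne_top,
          lintegral_exp_neg_mul_sq_norm n (by norm_num : (0 : ℝ) < 2⁻¹), inv_inv,
          ← ENNReal.ofReal_mul (by positivity)]
    _ ≤ _ := by
        apply ENNReal.ofReal_le_ofReal
        have h2 : (2 : ℝ) ^ n ≤ Real.exp n := by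
          rw [← Real.exp_one_pow]
          gcongr
          linarith [Real.add_one_le_exp (1 : ℝ)]
        have hn : (n : ℝ) ≤ n ^ 2 := by exact_mod_cast Nat.le_self_pow two_ne_zero n
        calc _ ≤ Real.exp (-(2 * n ^ 2)) * Real.exp n := by gcongr
          _ ≤ _ := by
            rw [← Real.exp_add]
            gcongr
            linarith

lemma lintegral_eq_mul_lintegral_comp_linearMap {E : Type*} [NormedAddCommGroup E]
    [NormedSpace ℝ E] [MeasurableSpace E] [BorelSpace E] [FiniteDimensional ℝ E] (μ : Measure E)
    [μ.IsAddHaarMeasure] {f : E →ₗ[ℝ] E} (hf : LinearMap.det f ≠ 0) {g : E → ENNReal}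
    (hg : Measurable g) :
    ∫⁻ x, g x ∂μ = ENNReal.ofReal |LinearMap.det f| * ∫⁻ x, g (f x) ∂μ := by
  rw [← lintegral_map hg f.continuous_of_finiteDimensional.measurable,
    Measure.map_linearMap_addHaar_eq_smul_addHaar μ hf, lintegral_smul_measure, smul_eq_mul,
    ← mul_assoc, ← ENNReal.ofReal_mul (abs_nonneg _), ← abs_mul, mul_inv_cancel₀ hf]
  simp

/-- A coordinate of a Gaussian vector is smaller than `r` with probability at most `e r²`. -/
lemma gammaC_norm_apply_lt_le {n : ℕ} (j : Fin n) {r : ℝ} (hr : 0 < r) :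
    gammaC n {c | ‖c j‖ < r} ≤ ENNReal.ofReal (Real.exp 1 * r ^ 2) := by
  classical
  have hA : MeasurableSet {c : EuclideanSpace ℂ (Fin n) | ‖c j‖ < r} :=
    (isOpen_lt (by fun_prop) continuous_const).measurableSet
  let d : Fin n → ℂ := Function.update 1 j r
  let e := (EuclideanSpace.basisFun (Fin n) ℂ).toBasis
  let f : EuclideanSpace ℂ (Fin n) →ₗ[ℂ] EuclideanSpace ℂ (Fin n) :=
    Matrix.toLin e e (Matrix.diagonal d)
  have hfdet : LinearMap.det f = r := by
    simp [f, LinearMap.det_toLin, d, Finset.prod_update_of_mem]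
  have hdet : LinearMap.det (f.restrictScalars ℝ) = r ^ 2 := by
    rw [LinearMap.det_restrictScalars, hfdet, Algebra.norm_complex_apply]
    simp [sq]
  have hfa (c : EuclideanSpace ℂ (Fin n)) (i : Fin n) : f c i = d i * c i := by
    simp [f, e, Matrix.toLin_apply, Matrix.mulVec_diagonal, Pi.single_apply]
  have hfj (c : EuclideanSpace ℂ (Fin n)) : ‖f c j‖ = r * ‖c j‖ := by
    simp [hfa, d, abs_of_pos hr]
  have hnorm (c : EuclideanSpace ℂ (Fin n)) : ‖c‖ ^ 2 ≤ ‖f c‖ ^ 2 + ‖c j‖ ^ 2 := by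
    simp only [EuclideanSpace.norm_sq_eq]
    rw [← Finset.add_sum_erase _ _ (Finset.mem_univ j),
      ← Finset.add_sum_erase _ (fun i => ‖f c i‖ ^ 2) (Finset.mem_univ j),
      Finset.sum_congr rfl fun i hi => show ‖c i‖ ^ 2 = ‖f c i‖ ^ 2 by
        simp [hfa, d, Function.update_of_ne (Finset.ne_of_mem_erase hi)]]
    linarith [sq_nonneg ‖f c j‖]
  rw [gammaC, withDensity_apply _ hA, ← lintegral_indicator hA,
    lintegral_eq_mul_lintegral_comp_linearMap volume (f := f.restrictScalars ℝ)
      (hdet ▸ by positivity) ((by fun_prop : Measurable _).indicator hA), hdet, abs_sq, mul_comm,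
    ENNReal.ofReal_mul (Real.exp_pos 1).le]
  gcongr
  calc _ ≤ ∫⁻ c : EuclideanSpace ℂ (Fin n), ENNReal.ofReal (Real.exp 1) *
          ENNReal.ofReal ((Real.pi ^ n)⁻¹ * Real.exp (-1 * ‖c‖ ^ 2)) := by
        refine lintegral_mono fun c => Set.indicator_apply_le' (fun hc => ?_) fun _ => zero_le
        have hc : ‖f c j‖ < r := hc
        have hcj : ‖c j‖ < 1 := by
          rw [hfj] at hc
          exact lt_of_mul_lt_mul_left (by simpa using hc) hr.le
        rw [← ENNReal.ofReal_mul (Real.exp_pos 1).le, mul_left_comm, ← Real.exp_add]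
        simp only [LinearMap.coe_restrictScalars]
        gcongr
        have := pow_le_one₀ (n := 2) (norm_nonneg (c j)) hcj.le
        linarith [hnorm c]
    _ = _ := by
        rw [lintegral_const_mul' _ _ ENNReal.ofReal_ne_top,
          lintegral_exp_neg_mul_sq_norm n one_pos]
        simp

/-- Almost surely, the coefficients of `f_N^ω` are eventually at most polynomially large, and the
extreme ones at least polynomially small. -/
lemma ae_eventually_norm_bounds (P : Measure ((N : ℕ) → EuclideanSpace ℂ (Fin (N + 1))))
    (hP : ∀ (N : ℕ) (A : Set (EuclideanSpace ℂ (Fin (N + 1)))), MeasurableSet A →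
      P {ω | ω N ∈ A} = gammaC (N + 1) A) :
    ∀ᵐ ω ∂P, ∀ᶠ N : ℕ in Filter.atTop, ‖ω N‖ ≤ 2 * ((N : ℝ) + 1) ∧
      ((N : ℝ) + 1)⁻¹ ≤ ‖ω N 0‖ ∧ ((N : ℝ) + 1)⁻¹ ≤ ‖ω N (Fin.last N)‖ := by
  have hsq : Summable fun N : ℕ => Real.exp 1 * (((N : ℝ) + 1)⁻¹) ^ 2 := by
    refine Summable.mul_left _ ?_
    have := (summable_nat_add_iff 1).2 (Real.summable_one_div_nat_pow.2 one_lt_two)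
    simpa using this
  have hexp : Summable fun N : ℕ => Real.exp (-((N + 1 : ℕ) : ℝ)) :=
    (summable_nat_add_iff 1).2 Real.summable_exp_neg_nat
  have hcoord (j : (N : ℕ) → Fin (N + 1)) :
      ∀ᵐ ω ∂P, ∀ᶠ N : ℕ in Filter.atTop, ((N : ℝ) + 1)⁻¹ ≤ ‖ω N (j N)‖ := by
    have h := ae_eventually_notMem (μ := P)
      (s := fun N => {ω | ω N ∈ {c | ‖c (j N)‖ < ((N : ℝ) + 1)⁻¹}})
      (ne_top_of_le_ne_top hsq.tsum_ofReal_ne_top <| ENNReal.tsum_le_tsum fun N => by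
        rw [hP N _ (isOpen_lt (by fun_prop) continuous_const).measurableSet]
        exact gammaC_norm_apply_lt_le (j N) (by positivity))
    simpa using h
  have hnorm : ∀ᵐ ω ∂P, ∀ᶠ N : ℕ in Filter.atTop, ‖ω N‖ ≤ 2 * ((N : ℝ) + 1) := by
    have h := ae_eventually_notMem (μ := P)
      (s := fun N => {ω | ω N ∈ {c | 2 * ((N + 1 : ℕ) : ℝ) < ‖c‖}})
      (ne_top_of_le_ne_top hexp.tsum_ofReal_ne_top <| ENNReal.tsum_le_tsum fun N => by
        rw [hP N _ (isOpen_lt continuous_const continuous_norm).measurableSet]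
        exact gammaC_lt_norm_le (N + 1))
    simpa using h
  filter_upwards [hnorm, hcoord fun N => 0, hcoord Fin.last] with ω h₁ h₂ h₃
  exact h₁.and (h₂.and h₃)

lemma coeff_sum_smul_X_pow {n : ℕ} (c : Fin n → ℂ) (j : Fin n) :
    (∑ i, c i • (Polynomial.X ^ (i : ℕ) : Polynomial ℂ)).coeff j = c j := by
  simp [Polynomial.coeff_X_pow, Fin.val_inj]

lemma natDegree_sum_smul_X_pow {N : ℕ} {c : Fin (N + 1) → ℂ} (hc : c (Fin.last N) ≠ 0) :
    (∑ i, c i • (Polynomial.X ^ (i : ℕ) : Polynomial ℂ)).natDegree = N := by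
  refine Polynomial.natDegree_eq_of_le_of_coeff_ne_zero ?_ ?_
  · refine Polynomial.natDegree_sum_le_of_forall_le _ _ fun i _ => ?_
    exact (Polynomial.natDegree_smul_le _ _).trans
      ((Polynomial.natDegree_X_pow_le _).trans (Fin.is_le i))
  · exact (coeff_sum_smul_X_pow c (Fin.last N)).trans_ne hc

lemma sum_norm_coeff_sum_smul_X_pow {N : ℕ} {c : Fin (N + 1) → ℂ} (hc : c (Fin.last N) ≠ 0) :
    ((∑ i, c i • (Polynomial.X ^ (i : ℕ) : Polynomial ℂ)).sum fun _ a => ‖a‖) = ∑ i, ‖c i‖ := by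
  rw [Polynomial.sum_over_range _ fun _ => norm_zero, natDegree_sum_smul_X_pow hc,
    ← Fin.sum_univ_eq_sum_range fun i => ‖Polynomial.coeff _ i‖]
  exact Finset.sum_congr rfl fun i _ => by rw [coeff_sum_smul_X_pow]

lemma tendsto_inv_mul_log_add_one :
    Filter.Tendsto (fun N : ℕ => (N : ℝ)⁻¹ * Real.log ((N : ℝ) + 1)) Filter.atTop (nhds 0) := by
  have h := (Real.tendsto_pow_log_div_mul_add_atTop 1 (-1) 1 one_ne_zero).comp
    (Filter.tendsto_atTop_add_const_right _ (1 : ℝ) tendsto_natCast_atTop_atTop)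
  simpa [Function.comp_def, div_eq_inv_mul] using h

/-- Almost sure equidistribution of zeros on the unit circle for the Kac-type ensemble:
if `P` is the product of the Gaussian measures `γ_{N+1}` (characterized by its values
on cylinder sets), then for `P`-almost every sequence of coefficients `ω`, the
normalized counting measures of the zeros of `f_N^ω(z) = ∑_{j=0}^N c_j^{(N)} zʲ`
converge weak* to the normalized arclength measure on the unit circle. -/
theorem kac_zeros_equidistribute_almost_surely
    (P : Measure ((N : ℕ) → EuclideanSpace ℂ (Fin (N + 1))))
    [IsProbabilityMeasure P]
    (hP : ∀ (s : Finset ℕ) (A : (N : ℕ) → Set (EuclideanSpace ℂ (Fin (N + 1)))),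
      (∀ N ∈ s, MeasurableSet (A N)) →
      P {ω | ∀ N ∈ s, ω N ∈ A N} = ∏ N ∈ s, gammaC (N + 1) (A N)) :
    ∀ᵐ ω ∂P, ∀ φ : ℂ → ℝ, Continuous φ → HasCompactSupport φ →
      Filter.Tendsto
        (fun N : ℕ => (N : ℝ)⁻¹ *
          ((∑ j : Fin (N + 1), ω N j • (Polynomial.X ^ (j : ℕ) : Polynomial ℂ)).roots.map
            φ).sum)
        Filter.atTop
        (nhds ((2 * Real.pi)⁻¹ *
          ∫ θ in (0 : ℝ)..(2 * Real.pi), φ (Complex.exp ((θ : ℂ) * Complex.I)))) := by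
  have hmarginal (N : ℕ) (A : Set (EuclideanSpace ℂ (Fin (N + 1)))) (hA : MeasurableSet A) :
      P {ω | ω N ∈ A} = gammaC (N + 1) A := by
    have h := hP {N} (Function.update (fun _ => Set.univ) N A) (by simpa using hA)
    simpa using h
  filter_upwards [ae_eventually_norm_bounds P hmarginal] with ω hω φ hφ hsupp
  have hpos (N : ℕ) : 0 < ((N : ℝ) + 1)⁻¹ := by positivity
  have hlog {N : ℕ} {x : ℝ} (hx : ((N : ℝ) + 1)⁻¹ ≤ x) : -Real.log x ≤ Real.log ((N : ℝ) + 1) := by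
    rw [neg_le, ← Real.log_inv]
    exact Real.log_le_log (hpos N) hx
  let B (N : ℕ) : ℝ := Real.log (2 * ((N : ℝ) + 1) ^ 2)
  have hB (N : ℕ) : B N = Real.log 2 + 2 * Real.log ((N : ℝ) + 1) := by
    simp only [B]
    rw [Real.log_mul two_ne_zero (by positivity), Real.log_pow, Nat.cast_two]
  have hB0 (N : ℕ) : 0 ≤ B N := Real.log_nonneg (by nlinarith [(Nat.cast_nonneg N : (0 : ℝ) ≤ N)])
  have hexpB {N : ℕ} (h : ‖ω N‖ ≤ 2 * ((N : ℝ) + 1)) (hl : ω N (Fin.last N) ≠ 0) :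
      ((∑ j : Fin (N + 1), ω N j • (Polynomial.X ^ (j : ℕ) : Polynomial ℂ)).sum
        fun _ a => ‖a‖) ≤ Real.exp (B N) := by
    rw [sum_norm_coeff_sum_smul_X_pow hl, Real.exp_log (by positivity)]
    calc _ ≤ ∑ _j : Fin (N + 1), 2 * ((N : ℝ) + 1) :=
          Finset.sum_le_sum fun j _ => (PiLp.norm_apply_le (ω N) j).trans h
      _ = _ := by
          simp
          ring
  have hdecay (K L : ℝ) : Filter.Tendsto
      (fun N : ℕ => (N : ℝ)⁻¹ * (K * Real.log ((N : ℝ) + 1) + L)) Filter.atTop (nhds 0) := by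
    have h := (tendsto_inv_mul_log_add_one.const_mul K).add
      (tendsto_inv_atTop_nhds_zero_nat (𝕜 := ℝ) |>.mul_const L)
    simp only [mul_zero, zero_mul, add_zero] at h
    exact h.congr fun N => by ring
  refine tendsto_sum_map_of_foldDisc ?_ ?_ ?_ (fun k hk => ?_) hφ hsupp
  · filter_upwards [hω] with N ⟨_, _, h⟩
    rw [IsAlgClosed.card_roots_eq_natDegree, natDegree_sum_smul_X_pow]
    exact norm_pos_iff.1 ((hpos N).trans_le h)
  · filter_upwards [hω] with N ⟨_, h, _⟩ hmem
    have h0 := Polynomial.zero_isRoot_iff_coeff_zero_eq_zero.1 (Polynomial.isRoot_of_mem_roots hmem)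
    exact norm_pos_iff.1 ((hpos N).trans_le h) ((coeff_sum_smul_X_pow (ω N) 0).symm.trans h0)
  · refine squeeze_zero' (Filter.Eventually.of_forall fun N => ?_) ?_
      (hdecay 6 (2 * Real.log 2))
    · refine mul_nonneg (by positivity) (Multiset.sum_nonneg ?_)
      simp only [Multiset.mem_map]
      rintro _ ⟨a, -, rfl⟩
      exact abs_nonneg _
    · filter_upwards [hω] with N ⟨h, h0, hl⟩
      have hl' := norm_pos_iff.1 ((hpos N).trans_le hl)
      have h0' := norm_pos_iff.1 ((hpos N).trans_le h0)
      gcongr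
      have hc0 := coeff_sum_smul_X_pow (ω N) 0
      refine (sum_abs_log_norm_roots_le (hc0.trans_ne h0') (hexpB h hl')).trans ?_
      have hlc := coeff_sum_smul_X_pow (ω N) (Fin.last N)
      rw [Fin.val_last] at hlc
      rw [Fin.val_zero] at hc0
      rw [Polynomial.leadingCoeff, natDegree_sum_smul_X_pow hl', hlc, hc0, hB]
      linarith [hlog h0, hlog hl]
  · refine squeeze_zero' (Filter.Eventually.of_forall fun N => by positivity) ?_
      (hdecay (2 * k * 5) (2 * k * (2 * Real.log 2)))
    filter_upwards [hω] with N ⟨h, h0, hl⟩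
    have hl' := norm_pos_iff.1 ((hpos N).trans_le hl)
    gcongr
    have hlc := coeff_sum_smul_X_pow (ω N) (Fin.last N)
    rw [Fin.val_last] at hlc
    refine (norm_sum_foldDisc_pow_le (fun hp => hl' (by simpa [hp] using hlc.symm)) (hB0 N)
      (hexpB h hl') hk).trans ?_
    rw [Polynomial.leadingCoeff, natDegree_sum_smul_X_pow hl', hlc, hB]
    calc _ ≤ 2 * k * (5 * Real.log ((N : ℝ) + 1) + 2 * Real.log 2) := by
          gcongr
          linarith [hlog hl]
      _ = _ := by ring
end
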